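/- Let {X_n} be a stationary and ergodic time series with values in a finite or countably infinite set 𝒳 and let f : 𝒳 → ℝ be bounded. On the event { K(X̃⁰_{−∞}) < ∞ }, almost surely for all sufficiently large j one has E(f(X_{λ_j+1}) | X_{−∞}^{λ_j}) = E(f(X_{λ_j+1}) | X_0^{λ_j}) = F(X̃⁰_{−∞}). -/

import Mathlib

open MeasureTheory Filter Set
open scoped ENNReal Topology

noncomputable section

namespace MWPrediction

/-- The canonical two-sided path space for a process with values in `𝒳`. -/
abbrev Path (𝒳 : Type*) := ℤ → 𝒳

variable {𝒳 : Type*}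

/-- The left shift `(T ω) i = ω (i+1)` on two-sided sequences. -/
def shift (ω : Path 𝒳) : Path 𝒳 := fun i => ω (i + 1)

/-- The one-sided past `X⁰_{-∞}`, recorded as `past ω i = X_{-i}`. -/
def past (ω : Path 𝒳) : ℕ → 𝒳 := fun i => ω (-(i : ℤ))

/-- The string `s` of length `m` (read right-to-left: `s j` is the symbol at
position `t - j`) occurs in `ω` ending at time `t`. -/
def OccursAt (ω : Path 𝒳) (m : ℕ) (s : ℕ → 𝒳) (t : ℤ) : Prop :=
  ∀ j < m, ω (t - (j : ℤ)) = s j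

/-- The auxiliary stopping times `ζ_n`:  `ζ_0 = 0` and `ζ_n` is obtained from
`ζ_{n-1}` by waiting for the recurrence of the block of length `l n` ending
at `ζ_{n-1}`. -/
def zeta (l : ℕ → ℕ) (ω : Path 𝒳) : ℕ → ℤ
  | 0 => 0
  | n + 1 =>
    zeta l ω n +
      ((sInf {t : ℕ | 0 < t ∧ ∀ s < l (n + 1),
          ω (zeta l ω n - (s : ℤ) + (t : ℤ)) = ω (zeta l ω n - (s : ℤ))} : ℕ) : ℤ)

/-- `J n = min { j ≥ 1 : l (j+1) > n }`. -/
def Jfun (l : ℕ → ℕ) (n : ℕ) : ℕ := sInf {j : ℕ | 1 ≤ j ∧ n < l (j + 1)}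

/-- The auxiliary process `X̃`: `tildePast l ω i = X̃_{-i} = X_{ζ_{J(i)} - i}`. -/
def tildePast (l : ℕ → ℕ) (ω : Path 𝒳) : ℕ → 𝒳 :=
  fun i => ω (zeta l ω (Jfun l i) - (i : ℤ))

variable [MeasurableSpace 𝒳]

/-- `pstr μ m s = P(X_{-m+1}^0 = s)`, the probability that the string `s` of
length `m` (read right-to-left) occupies positions `-m+1, …, 0`.
(So `pstr μ (k+1)` is `p_k` of the paper.) -/
def pstr (μ : Measure (Path 𝒳)) (m : ℕ) (s : ℕ → 𝒳) : ℝ :=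
  (μ {ω | ∀ j < m, ω (-(j : ℤ)) = s j}).toReal

/-- `pcond μ m y s = P(X_1 = y | X_{-m+1}^0 = s)`, conditioning on `m` symbols.
(So `pcond μ m` is `p_{m-1}(·|·)` of the paper.) -/
def pcond (μ : Measure (Path 𝒳)) (m : ℕ) (y : 𝒳) (s : ℕ → 𝒳) : ℝ :=
  (μ {ω | ω 1 = y ∧ ∀ j < m, ω (-(j : ℤ)) = s j}).toReal / pstr μ m s

/-- Append `y` as the new rightmost symbol of the string `s`. -/
def withLast (y : 𝒳) (s : ℕ → 𝒳) : ℕ → 𝒳 := fun j => if j = 0 then y else s (j - 1)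

/-- The string which agrees with `b` on its rightmost `k` symbols and continues
to the left with `z`:  this is the string `(z, b_{-k+1}^0)` of the paper. -/
def prependOld (b : ℕ → 𝒳) (k : ℕ) (z : ℕ → 𝒳) : ℕ → 𝒳 :=
  fun j => if j < k then b j else z (j - k)

/-- `K` is a memory bound for the past `b`: for all `i ≥ 1`, `y` and `z ∈ 𝒳^i`,
if `p_{K+i}(z, b_{-K+1}^0, y) > 0` then
`p_{K-1}(y | b_{-K+1}^0) = p_{K+i-1}(y | z, b_{-K+1}^0)`. -/
def IsMemoryBound (μ : Measure (Path 𝒳)) (b : ℕ → 𝒳) (K : ℕ) : Prop :=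
  ∀ i : ℕ, 1 ≤ i → ∀ y : 𝒳, ∀ z : ℕ → 𝒳,
    0 < pstr μ (K + i + 1) (withLast y (prependOld b K z)) →
    pcond μ K y b = pcond μ (K + i) y (prependOld b K z)

/-- The (random) memory length `K(b)` of a one-sided path `b`: the smallest
memory bound, and `∞` if there is none. -/
def memLen (μ : Measure (Path 𝒳)) (b : ℕ → 𝒳) : ℕ∞ :=
  sInf {n : ℕ∞ | ∃ K : ℕ, n = (K : ℕ∞) ∧ IsMemoryBound μ b K}

/-- `Δ_k(b_{-k+1}^0)`. -/
def Delta (μ : Measure (Path 𝒳)) (k : ℕ) (b : ℕ → 𝒳) : ℝ :=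
  sSup {d : ℝ | ∃ i : ℕ, 1 ≤ i ∧ ∃ z : ℕ → 𝒳, ∃ x : 𝒳,
    0 < pstr μ (k + i + 1) (withLast x (prependOld b k z)) ∧
    d = |pcond μ k x b - pcond μ (k + i) x (prependOld b k z)|}

/-- `⌈n/2⌉`. -/
def half (n : ℕ) : ℕ := (n + 1) / 2

open Classical in
/-- The number of times `t ∈ [a, b]` at which the string `s` of length `m`
occurs in `ω` ending at `t`. -/
def cnt (ω : Path 𝒳) (m : ℕ) (s : ℕ → 𝒳) (a b : ℤ) : ℕ :=
  ((Finset.Icc a b).filter fun t => OccursAt ω m s t).card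

/-- Membership in `ℒ_{n,m}^{(1)}`: the string `s` of length `m+1` occurs in
`X_0^{⌈n/2⌉ - 1}`. -/
def inL1 (ω : Path 𝒳) (n m : ℕ) (s : ℕ → 𝒳) : Prop :=
  ∃ t : ℤ, (m : ℤ) ≤ t ∧ t ≤ (half n : ℤ) - 1 ∧ OccursAt ω (m + 1) s t

/-- Membership in `ℒ_{n,m}^{(2)}`: the string `s` of length `m+1` occurs more
than `n^{1-γ}` times in `X_{⌈n/2⌉}^n`. -/
def inL2 (γ : ℝ) (ω : Path 𝒳) (n m : ℕ) (s : ℕ → 𝒳) : Prop :=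
  (n : ℝ) ^ (1 - γ) < (cnt ω (m + 1) s ((half n : ℤ) + (m : ℤ)) (n : ℤ) : ℝ)

/-- Membership in `ℒ_m^n = ℒ_{n,m}^{(1)} ∩ ℒ_{n,m}^{(2)}`. -/
def inL (γ : ℝ) (ω : Path 𝒳) (n m : ℕ) (s : ℕ → 𝒳) : Prop :=
  inL1 ω n m s ∧ inL2 γ ω n m s

/-- The empirical conditional relative frequency of `x` following the string
`s` of length `m`, computed in the second half `X_{⌈n/2⌉}^n` of the data. -/
def empCond (ω : Path 𝒳) (n m : ℕ) (x : 𝒳) (s : ℕ → 𝒳) : ℝ :=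
  (cnt ω (m + 1) (withLast x s) ((half n : ℤ) + (m : ℤ)) (n : ℤ) : ℝ) /
    (cnt ω m s ((half n : ℤ) + (m : ℤ) - 1) ((n : ℤ) - 1) : ℝ)

/-- The empirical statistic `Δ̂_k^n(X̃_{-k+1}^0)`. -/
def hatDelta (γ : ℝ) (l : ℕ → ℕ) (ω : Path 𝒳) (n k : ℕ) : ℝ :=
  (if zeta l ω (Jfun l k) ≤ (half n : ℤ) - 1 then (1 : ℝ) else 0) *
    sSup {d : ℝ | ∃ i : ℕ, 1 ≤ i ∧ i ≤ n ∧ ∃ z : ℕ → 𝒳, ∃ x : 𝒳,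
      inL γ ω n (k + i) (withLast x (prependOld (tildePast l ω) k z)) ∧
      d = |empCond ω n k x (tildePast l ω) -
            empCond ω n (k + i) x (prependOld (tildePast l ω) k z)|}

/-- The order estimate `χ_n`: the smallest `0 ≤ k < n` with `Δ̂_k^n ≤ n^{-β}`
(and `χ_0 = 0`). -/
def chi (β γ : ℝ) (l : ℕ → ℕ) (ω : Path 𝒳) (n : ℕ) : ℕ :=
  sInf {k : ℕ | k < n ∧ hatDelta γ l ω n k ≤ (n : ℝ) ^ (-β)}

/-- The index `j` with `ζ_j ≤ v < ζ_{j+1}`. -/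
def jIndex (l : ℕ → ℕ) (ω : Path 𝒳) (v : ℤ) : ℕ := sInf {j : ℕ | v < zeta l ω (j + 1)}

/-- The stopping times `λ_n`:  `λ_0 = 0` and, if `ζ_j ≤ λ_{n-1} < ζ_{j+1}`,
`λ_n = min { t > λ_{n-1} : X_{t - χ_t + 1}^t = X_{ζ_j - χ_t + 1}^{ζ_j} }`. -/
def lambda (β γ : ℝ) (l : ℕ → ℕ) (ω : Path 𝒳) : ℕ → ℤ
  | 0 => 0
  | n + 1 =>
    lambda β γ l ω n + 1 +
      ((sInf {s : ℕ |
          ∀ r < chi β γ l ω (lambda β γ l ω n + 1 + (s : ℤ)).toNat,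
            ω (lambda β γ l ω n + 1 + (s : ℤ) - (r : ℤ)) =
              ω (zeta l ω (jIndex l ω (lambda β γ l ω n)) - (r : ℤ))} : ℕ) : ℤ)

/-- `κ_n = χ_{λ_n}`. -/
def kappa (β γ : ℝ) (l : ℕ → ℕ) (ω : Path 𝒳) (n : ℕ) : ℕ :=
  chi β γ l ω (lambda β γ l ω n).toNat

/-- The estimator `f_n = (1/n) ∑_{j=0}^{n-1} f(X_{λ_j + 1})`. -/
def fEst (β γ : ℝ) (l : ℕ → ℕ) (f : 𝒳 → ℝ) (ω : Path 𝒳) (n : ℕ) : ℝ :=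
  (1 / (n : ℝ)) * ∑ j ∈ Finset.range n, f (ω (lambda β γ l ω j + 1))

open Classical in
/-- The metric `d*` on one-sided sequences. -/
def dstar (x y : ℕ → 𝒳) : ℝ :=
  ∑' i : ℕ, (2 : ℝ)⁻¹ ^ (i + 1) * (if x i ≠ y i then 1 else 0)

/-- `F` restricted to `C` is continuous with respect to the metric `d*`. -/
def ContinuousOnDstar (F : (ℕ → 𝒳) → ℝ) (C : Set (ℕ → 𝒳)) : Prop :=
  ∀ x ∈ C, ∀ ε > 0, ∃ δ > 0, ∀ y ∈ C, dstar x y < δ → |F y - F x| < ε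

/-- The σ-algebra generated by the one-sided past `X^0_{-∞}`. -/
def pastSigma (𝒳 : Type*) [MeasurableSpace 𝒳] : MeasurableSpace (Path 𝒳) :=
  MeasurableSpace.comap past inferInstance

/-- `F` is a version of the conditional expectation `E(f(X_1) | X^0_{-∞})`. -/
def IsPredictor (μ : Measure (Path 𝒳)) (f : 𝒳 → ℝ) (F : (ℕ → 𝒳) → ℝ) : Prop :=
  (fun ω => F (past ω)) =ᵐ[μ] μ[fun ω => f (ω 1)|pastSigma 𝒳]

/-- `F` (a version of `E(f(X_1)|X^0_{-∞})`) is almost surely continuous: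
it is continuous w.r.t. `d*` on a set of paths of probability one. -/
def ASContinuousCondExp (μ : Measure (Path 𝒳)) (F : (ℕ → 𝒳) → ℝ) : Prop :=
  ∃ C : Set (ℕ → 𝒳), μ (past ⁻¹' C) = 1 ∧ ContinuousOnDstar F C

/-- The observation `(λ_j, X_0^{λ_j})`, encoding the data segment available at
time `λ_j` (values before time `0` are clamped to `X_0`). -/
def segObs (β γ : ℝ) (l : ℕ → ℕ) (j : ℕ) (ω : Path 𝒳) : ℤ × (ℕ → 𝒳) :=
  (lambda β γ l ω j, fun i => ω (max (lambda β γ l ω j - (i : ℤ)) 0))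

/-- The σ-algebra generated by `(λ_j, X_0^{λ_j})`. -/
def segSigma (β γ : ℝ) (l : ℕ → ℕ) (j : ℕ) : MeasurableSpace (Path 𝒳) :=
  MeasurableSpace.comap (segObs β γ l j) inferInstance

/-- The observation `(λ_j, X_{-∞}^{λ_j})`: the full past at time `λ_j`. -/
def fullPastObs (β γ : ℝ) (l : ℕ → ℕ) (j : ℕ) (ω : Path 𝒳) : ℤ × (ℕ → 𝒳) :=
  (lambda β γ l ω j, fun i => ω (lambda β γ l ω j - (i : ℤ)))

/-- The σ-algebra generated by `(λ_j, X_{-∞}^{λ_j})`. -/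
def fullPastSigma (β γ : ℝ) (l : ℕ → ℕ) (j : ℕ) : MeasurableSpace (Path 𝒳) :=
  MeasurableSpace.comap (fullPastObs β γ l j) inferInstance

/-- The `n`-th term `-(1/(n+1)) ∑ p log₂ p` of the entropy rate. -/
def entropyTerm (μ : Measure (Path 𝒳)) (n : ℕ) : ℝ :=
  -(1 / ((n : ℝ) + 1)) *
    ∑' s : Fin (n + 1) → 𝒳,
      pstr μ (n + 1) (fun j => if h : j < n + 1 then s ⟨j, h⟩ else s ⟨0, Nat.succ_pos n⟩) *
        Real.logb 2
          (pstr μ (n + 1) (fun j => if h : j < n + 1 then s ⟨j, h⟩ else s ⟨0, Nat.succ_pos n⟩))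

/-- The process has entropy rate `H`. -/
def HasEntropyRate (μ : Measure (Path 𝒳)) (H : ℝ) : Prop :=
  Tendsto (entropyTerm μ) atTop (nhds H)

/-- The backward stopping times `ζ̂_i^k`. -/
def hatZeta (l : ℕ → ℕ) (k : ℕ) (ω : Path 𝒳) : ℕ → ℤ
  | 0 => 0
  | i + 1 =>
    hatZeta l k ω i -
      ((sInf {t : ℕ | 0 < t ∧ ∀ s < l (k - i),
          ω (hatZeta l k ω i - (s : ℤ) - (t : ℤ)) = ω (hatZeta l k ω i - (s : ℤ))} : ℕ) : ℤ)

set_option linter.unusedSectionVars false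

section Birkhoff

variable {Ω : Type*}

/-- The running maximum `max (0, S_1, …, S_n)` of the Birkhoff sums of `g`. -/
def maxBirkhoff (T : Ω → Ω) (g : Ω → ℝ) : ℕ → Ω → ℝ
  | 0 => fun _ => 0
  | n + 1 => fun ω => max 0 (g ω + maxBirkhoff T g n (T ω))

variable {T : Ω → Ω} {g : Ω → ℝ}

lemma maxBirkhoff_nonneg (n : ℕ) (ω : Ω) : 0 ≤ maxBirkhoff T g n ω := by
  cases n with
  | zero => exact le_rfl
  | succ n => exact le_max_left _ _

lemma maxBirkhoff_le_succ (n : ℕ) : ∀ ω, maxBirkhoff T g n ω ≤ maxBirkhoff T g (n + 1) ω := by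
  induction n with
  | zero => exact fun ω => maxBirkhoff_nonneg 1 ω
  | succ n ih => exact fun ω => max_le_max le_rfl (by linarith [ih (T ω)])

lemma monotone_maxBirkhoff (ω : Ω) : Monotone fun n => maxBirkhoff T g n ω :=
  monotone_nat_of_le_succ fun n => maxBirkhoff_le_succ n ω

lemma birkhoffSum_le_maxBirkhoff (n : ℕ) :
    ∀ ω, birkhoffSum T g n ω ≤ maxBirkhoff T g n ω := by
  induction n with
  | zero => intro ω; simp [maxBirkhoff]
  | succ n ih =>
    intro ω
    rw [birkhoffSum_succ']
    exact le_max_of_le_right (by linarith [ih (T ω)])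

lemma maxBirkhoff_le {M : ℝ} (hM : ∀ ω, |g ω| ≤ M) (n : ℕ) :
    ∀ ω, maxBirkhoff T g n ω ≤ n * M := by
  induction n with
  | zero => intro ω; simp [maxBirkhoff]
  | succ n ih =>
    intro ω
    have h0 : 0 ≤ M := (abs_nonneg _).trans (hM ω)
    push_cast
    exact max_le (by positivity) (by linarith [ih (T ω), le_of_abs_le (hM ω)])

variable [MeasurableSpace Ω]

lemma measurable_maxBirkhoff (hT : Measurable T) (hg : Measurable g) (n : ℕ) :
    Measurable (maxBirkhoff T g n) := by
  induction n with
  | zero => exact measurable_const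
  | succ n ih => exact measurable_const.max (hg.add (ih.comp hT))

/-- A bounded function of negative mean has almost surely bounded above Birkhoff sums. -/
lemma ae_bddAbove_birkhoffSum {μ : Measure Ω} [IsProbabilityMeasure μ] (hT : Ergodic T μ)
    (hg : Measurable g) {M : ℝ} (hM : ∀ ω, |g ω| ≤ M) (hneg : ∫ ω, g ω ∂μ < 0) :
    ∀ᵐ ω ∂μ, ∃ C, ∀ n, birkhoffSum T g n ω ≤ C := by
  have hmeas := measurable_maxBirkhoff hT.measurable hg
  set A : Set Ω := {ω | BddAbove (range fun n => maxBirkhoff T g n ω)} with hA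
  have hAm : MeasurableSet A := measurableSet_bddAbove_range hmeas
  have hinv : T ⁻¹' A = A := by
    ext ω
    simp only [hA, mem_preimage, mem_ofPred_eq, BddAbove, Set.Nonempty, mem_upperBounds,
      forall_mem_range]
    constructor
    · rintro ⟨C, hC⟩
      refine ⟨max 0 (g ω + C), fun n => (maxBirkhoff_le_succ n ω).trans ?_⟩
      exact max_le_max le_rfl (by linarith [hC n])
    · rintro ⟨C, hC⟩
      refine ⟨C - g ω, fun n => ?_⟩
      have : g ω + maxBirkhoff T g n (T ω) ≤ maxBirkhoff T g (n + 1) ω := le_max_right _ _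
      linarith [hC (n + 1)]
  rcases hT.toPreErgodic.ae_empty_or_univ hAm hinv with h | h
  · exfalso
    have hnot : ∀ᵐ ω ∂μ, ω ∉ A := by
      filter_upwards [h.mem_iff] with ω hω hmem
      exact hω.1 hmem
    have htop : ∀ᵐ ω ∂μ, Tendsto (fun n => maxBirkhoff T g n (T ω)) atTop atTop := by
      filter_upwards [hnot] with ω hω
      refine tendsto_atTop_atTop_of_monotone' (monotone_maxBirkhoff _) fun hb => hω ?_
      rw [← hinv]; exact hb
    have hlim : Tendsto (fun n => ∫ ω, max (-maxBirkhoff T g n (T ω)) (g ω) ∂μ) atTop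
        (𝓝 (∫ ω, g ω ∂μ)) := by
      refine tendsto_integral_of_dominated_convergence (fun _ => M) (fun n => ?_)
        (integrable_const _) (fun n => ae_of_all _ fun ω => ?_) ?_
      · exact (((hmeas n).comp hT.measurable).neg.max hg).aestronglyMeasurable
      · rw [Real.norm_eq_abs, abs_le]
        have h1 := abs_le.1 (hM ω)
        exact ⟨h1.1.trans (le_max_right _ _),
          max_le (by linarith [maxBirkhoff_nonneg (T := T) (g := g) n (T ω)]) h1.2⟩
      · filter_upwards [htop] with ω hω
        refine tendsto_const_nhds.congr' ?_
        filter_upwards [hω.eventually_ge_atTop (-g ω)] with n hn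
        exact (max_eq_right (by linarith)).symm
    have hint : ∀ n, Integrable (maxBirkhoff T g n) μ := fun n =>
      Integrable.of_bound (hmeas n).aestronglyMeasurable (n * M) (ae_of_all _ fun ω => by
        rw [Real.norm_eq_abs, abs_of_nonneg (maxBirkhoff_nonneg n ω)]
        exact maxBirkhoff_le hM n ω)
    refine absurd (ge_of_tendsto' hlim fun n => ?_) (not_le.2 hneg)
    have hcomp : ∫ ω, maxBirkhoff T g n (T ω) ∂μ = ∫ ω, maxBirkhoff T g n ω ∂μ := by
      rw [← integral_map hT.measurable.aemeasurable
        (hmeas n).aestronglyMeasurable, hT.map_eq]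
    have heq : ∀ ω, max (-maxBirkhoff T g n (T ω)) (g ω)
        = maxBirkhoff T g (n + 1) ω - maxBirkhoff T g n (T ω) := by
      intro ω
      simp only [maxBirkhoff]
      rw [← max_sub_sub_right]
      congr 1 <;> ring
    simp_rw [heq]
    rw [integral_sub (hint _) (g := fun ω => maxBirkhoff T g n (T ω))
      (hT.toMeasurePreserving.integrable_comp_of_integrable (hint n)), hcomp, sub_nonneg]
    exact integral_mono (hint _) (hint _) (maxBirkhoff_le_succ n)
  · filter_upwards [h.mem_iff] with ω hω
    obtain ⟨C, hC⟩ : ω ∈ A := hω.2 (mem_univ _)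
    exact ⟨C, fun n => (birkhoffSum_le_maxBirkhoff n ω).trans (hC ⟨n, rfl⟩)⟩

/-- One half of the pointwise ergodic theorem for bounded functions. -/
lemma ae_eventually_birkhoffSum_lt {μ : Measure Ω} [IsProbabilityMeasure μ] (hT : Ergodic T μ)
    (hg : Measurable g) {M : ℝ} (hM : ∀ ω, |g ω| ≤ M) {c : ℝ} (hc : ∫ ω, g ω ∂μ < c) :
    ∀ᵐ ω ∂μ, ∀ᶠ n : ℕ in atTop, birkhoffSum T g n ω / n < c := by
  obtain ⟨d, hd, hdc⟩ := exists_between hc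
  have hint : Integrable g μ := Integrable.of_bound hg.aestronglyMeasurable M (ae_of_all _ hM)
  have := ae_bddAbove_birkhoffSum (g := fun ω => g ω - d) hT (hg.sub_const d) (M := M + |d|)
    (fun ω => (abs_sub _ _).trans (by linarith [hM ω]))
    (by rw [integral_sub hint (integrable_const _)]; simpa using hd)
  filter_upwards [this] with ω ⟨C, hC⟩
  have hlim : Tendsto (fun n : ℕ => C / n + d) atTop (𝓝 (0 + d)) :=
    (tendsto_const_div_atTop_nhds_zero_nat C).add_const d
  rw [zero_add] at hlim
  filter_upwards [hlim.eventually_lt_const hdc, eventually_gt_atTop 0] with n hn hn0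
  have hn0' : (0 : ℝ) < n := by exact_mod_cast hn0
  refine lt_of_le_of_lt ?_ hn
  have h1 := hC n
  have h2 : birkhoffSum T (fun ω => g ω - d) n ω = birkhoffSum T g n ω - n * d := by
    simp [birkhoffSum, Finset.sum_sub_distrib]
  rw [h2] at h1
  rw [div_le_iff₀ hn0', add_mul, div_mul_cancel₀ _ hn0'.ne']
  linarith

/-- Birkhoff's pointwise ergodic theorem for bounded functions. -/
theorem ae_tendsto_birkhoffSum_div {μ : Measure Ω} [IsProbabilityMeasure μ] (hT : Ergodic T μ)
    (hg : Measurable g) {M : ℝ} (hM : ∀ ω, |g ω| ≤ M) :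
    ∀ᵐ ω ∂μ, Tendsto (fun n : ℕ => birkhoffSum T g n ω / n) atTop (𝓝 (∫ ω, g ω ∂μ)) := by
  have hup : ∀ᵐ ω ∂μ, ∀ k : ℕ, ∀ᶠ n : ℕ in atTop,
      birkhoffSum T g n ω / n < ∫ ω, g ω ∂μ + 1 / (k + 1) := by
    rw [ae_all_iff]
    intro k
    exact ae_eventually_birkhoffSum_lt hT hg hM (lt_add_of_pos_right _ (by positivity))
  have hlow : ∀ᵐ ω ∂μ, ∀ k : ℕ, ∀ᶠ n : ℕ in atTop,
      birkhoffSum T (fun ω => -g ω) n ω / n < -∫ ω, g ω ∂μ + 1 / (k + 1) := by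
    rw [ae_all_iff]
    intro k
    refine ae_eventually_birkhoffSum_lt (g := fun ω => -g ω) hT hg.neg (M := M) (by simpa using hM) ?_
    rw [integral_neg]
    exact lt_add_of_pos_right _ (by positivity)
  filter_upwards [hup, hlow] with ω h1 h2
  rw [Metric.tendsto_atTop']
  intro ε hε
  obtain ⟨k, hk⟩ := exists_nat_one_div_lt hε
  obtain ⟨N, hN⟩ := eventually_atTop.1 ((h1 k).and (h2 k))
  refine ⟨N, fun n hn => ?_⟩
  obtain ⟨ha, hb⟩ := hN n hn.le
  have : birkhoffSum T (fun ω => -g ω) n ω = -birkhoffSum T g n ω := by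
    simp [birkhoffSum]
  rw [this, neg_div] at hb
  rw [Real.dist_eq, abs_lt]
  constructor <;> linarith

end Birkhoff

section Strings

lemma ae_forall_string [Countable 𝒳] {Ω : Type*} {_ : MeasurableSpace Ω} {μ : Measure Ω} (m : ℕ)
    {p : Ω → (ℕ → 𝒳) → Prop}
    (hc : ∀ ω s s', (∀ j < m, s j = s' j) → p ω s → p ω s') (h : ∀ s, ∀ᵐ ω ∂μ, p ω s) :
    ∀ᵐ ω ∂μ, ∀ s, p ω s := by
  rcases isEmpty_or_nonempty 𝒳 with he | ⟨⟨x₀⟩⟩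
  · exact ae_of_all _ fun ω s => (he.false (s 0)).elim
  · have : ∀ᵐ ω ∂μ, ∀ u : Fin m → 𝒳, p ω fun j => if hj : j < m then u ⟨j, hj⟩ else x₀ :=
      ae_all_iff.2 fun u => h _
    filter_upwards [this] with ω hω s
    exact hc _ _ _ (fun j hj => by simp [hj]) (hω fun j => s j)

/-- The set of one-sided sequences starting with the first `m` letters of `s`. -/
def pastCyl (m : ℕ) (s : ℕ → 𝒳) : Set (ℕ → 𝒳) := {x | ∀ j < m, x j = s j}

lemma mem_pastCyl {m : ℕ} {s x : ℕ → 𝒳} : x ∈ pastCyl m s ↔ ∀ j < m, x j = s j := Iff.rfl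

/-- The set of paths whose last `m` symbols up to time `0` are given by `s`. -/
def cyl (m : ℕ) (s : ℕ → 𝒳) : Set (Path 𝒳) := {ω | ∀ j < m, ω (-(j : ℤ)) = s j}

lemma mem_cyl {m : ℕ} {s : ℕ → 𝒳} {ω : Path 𝒳} : ω ∈ cyl m s ↔ ∀ j < m, ω (-(j : ℤ)) = s j :=
  Iff.rfl

lemma past_preimage_pastCyl (m : ℕ) (s : ℕ → 𝒳) : past ⁻¹' pastCyl m s = cyl m s := rfl

lemma cyl_congr {m : ℕ} {s s' : ℕ → 𝒳} (h : ∀ j < m, s j = s' j) : cyl m s = cyl m s' := by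
  ext ω
  exact forall₂_congr fun j hj => by rw [h j hj]

variable [MeasurableSingletonClass 𝒳]

lemma measurableSet_pastCyl (m : ℕ) (s : ℕ → 𝒳) : MeasurableSet (pastCyl m s) := by
  have : pastCyl m s = ⋂ j, ⋂ (_ : j < m), (fun x : ℕ → 𝒳 => x j) ⁻¹' {s j} := by
    ext x; simp [mem_pastCyl]
  rw [this]
  exact MeasurableSet.iInter fun j => MeasurableSet.iInter fun _ =>
    measurable_pi_apply j (measurableSet_singleton _)

lemma isPiSystem_pastCyl : IsPiSystem {S : Set (ℕ → 𝒳) | ∃ m s, S = pastCyl m s} := by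
  rintro _ ⟨m, s, rfl⟩ _ ⟨n, u, rfl⟩ ⟨x, hx, hy⟩
  refine ⟨max m n, x, ?_⟩
  ext y
  simp only [mem_inter_iff, mem_pastCyl] at *
  constructor
  · rintro ⟨h1, h2⟩ j hj
    rcases lt_max_iff.1 hj with hj | hj
    · rw [h1 j hj, hx j hj]
    · rw [h2 j hj, hy j hj]
  · intro h
    exact ⟨fun j hj => by rw [h j (lt_max_of_lt_left hj), hx j hj],
      fun j hj => by rw [h j (lt_max_of_lt_right hj), hy j hj]⟩

lemma generateFrom_pastCyl [Countable 𝒳] :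
    (inferInstance : MeasurableSpace (ℕ → 𝒳)) =
      MeasurableSpace.generateFrom {S | ∃ m s, S = pastCyl m s} := by
  apply le_antisymm
  · refine iSup_le fun j => ?_
    rw [← measurable_iff_comap_le]
    refine @measurable_to_countable' _ _ _ _
      (MeasurableSpace.generateFrom {S | ∃ m s, S = pastCyl m s}) _ fun a => ?_
    have : (fun x : ℕ → 𝒳 => x j) ⁻¹' {a}
        = ⋃ u : {u : Fin (j + 1) → 𝒳 // u (Fin.last j) = a},
          pastCyl (j + 1) fun i => if h : i < j + 1 then u.1 ⟨i, h⟩ else a := by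
      ext x
      simp only [mem_preimage, mem_singleton_iff, mem_iUnion, mem_pastCyl]
      constructor
      · intro hx
        exact ⟨⟨fun i => x i, by simpa using hx⟩, fun i hi => by simp [hi]⟩
      · rintro ⟨⟨u, hu⟩, h⟩
        rw [h j (Nat.lt_succ_self j), dif_pos (Nat.lt_succ_self j)]
        exact hu
    rw [this]
    exact @MeasurableSet.iUnion _ _
      (MeasurableSpace.generateFrom {S | ∃ m s, S = pastCyl m s}) _ _
      fun u => MeasurableSpace.measurableSet_generateFrom ⟨_, _, rfl⟩
  · refine MeasurableSpace.generateFrom_le ?_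
    rintro _ ⟨m, s, rfl⟩
    exact measurableSet_pastCyl m s

lemma measure_ext_pastCyl [Countable 𝒳] {ν₁ ν₂ : Measure (ℕ → 𝒳)} [IsFiniteMeasure ν₁]
    (huniv : ν₁ univ = ν₂ univ) (h : ∀ m s, ν₁ (pastCyl m s) = ν₂ (pastCyl m s)) : ν₁ = ν₂ := by
  refine ext_of_generate_finite _ generateFrom_pastCyl isPiSystem_pastCyl ?_ huniv
  rintro _ ⟨m, s, rfl⟩
  exact h m s

end Strings

section Measurability

lemma measurable_apply_countable {Ω ι β : Type*} [MeasurableSpace Ω] [MeasurableSpace β]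
    [Countable ι] [MeasurableSpace ι] [MeasurableSingletonClass ι] {N : Ω → ι} (hN : Measurable N)
    {h : ι → Ω → β} (hh : ∀ i, Measurable (h i)) : Measurable fun ω => h (N ω) ω :=
  (measurable_from_prod_countable_right (f := fun p : ι × Ω => h p.1 p.2) hh).comp
    (hN.prodMk measurable_id)

lemma measurable_sInf_nat {Ω : Type*} [MeasurableSpace Ω] {p : ℕ → Ω → Prop}
    (hp : ∀ n, MeasurableSet {ω | p n ω}) : Measurable fun ω => sInf {n | p n ω} := by
  refine measurable_of_Iic fun n => ?_
  have : (fun ω => sInf {n | p n ω}) ⁻¹' Iic n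
      = (⋃ k, ⋃ (_ : k ≤ n), {ω | p k ω}) ∪ ⋂ k, {ω | p k ω}ᶜ := by
    ext ω
    simp only [mem_preimage, mem_Iic, mem_union, mem_iUnion, mem_iInter, mem_compl_iff,
      mem_ofPred_eq, exists_prop]
    constructor
    · intro h
      rcases Set.eq_empty_or_nonempty {n | p n ω} with h0 | h0
      · exact Or.inr fun k hk => (h0 ▸ (show k ∈ {n | p n ω} from hk) : k ∈ (∅ : Set ℕ))
      · exact Or.inl ⟨_, h, Nat.sInf_mem h0⟩
    · rintro (⟨k, hk, hpk⟩ | h)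
      · exact (Nat.sInf_le hpk).trans hk
      · have : {n | p n ω} = ∅ := Set.eq_empty_of_forall_notMem h
        simp [this]
  rw [this]
  exact (MeasurableSet.iUnion fun k => MeasurableSet.iUnion fun _ => hp k).union
    (MeasurableSet.iInter fun k => (hp k).compl)

lemma measurable_of_factors {Ω α β : Type*} [MeasurableSpace Ω] [MeasurableSpace α]
    [MeasurableSpace β] [Countable α] [MeasurableSingletonClass α] {φ : Ω → α}
    (hφ : Measurable φ) {g : Ω → β} (h : ∀ ω ω', φ ω = φ ω' → g ω = g ω') : Measurable g := by
  intro S _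
  have : g ⁻¹' S = φ ⁻¹' (φ '' (g ⁻¹' S)) := by
    ext ω
    constructor
    · exact fun hω => ⟨ω, hω, rfl⟩
    · rintro ⟨ω', hω', he⟩
      rw [mem_preimage, ← h _ _ he]
      exact hω'
  rw [this]
  exact hφ (Set.to_countable _).measurableSet

end Measurability

section Recurrence

/-- The path shifted by `u` time units. -/
def tshift (u : ℤ) (ω : Path 𝒳) : Path 𝒳 := fun i => ω (i + u)

lemma measurable_tshift (u : ℤ) : Measurable (tshift u : Path 𝒳 → Path 𝒳) :=
  measurable_pi_lambda _ fun i => measurable_pi_apply (i + u)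

lemma measurable_past : Measurable (past : Path 𝒳 → ℕ → 𝒳) :=
  measurable_pi_lambda _ fun i => measurable_pi_apply (-(i : ℤ))

lemma shift_iterate (n : ℕ) : (shift : Path 𝒳 → Path 𝒳)^[n] = tshift n := by
  induction n with
  | zero => funext ω i; simp [tshift]
  | succ n ih =>
    funext ω i
    rw [Function.iterate_succ_apply', ih]
    simp only [shift, tshift]
    congr 1
    push_cast
    ring

variable {μ : Measure (Path 𝒳)}

lemma measurePreserving_tshift (h : MeasurePreserving shift μ μ) (n : ℕ) :
    MeasurePreserving (tshift (n : ℤ)) μ μ := by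
  rw [← shift_iterate]
  exact h.iterate n

variable [Countable 𝒳] [MeasurableSingletonClass 𝒳]

lemma measurableSet_cyl (m : ℕ) (s : ℕ → 𝒳) : MeasurableSet (cyl m s) :=
  measurable_past (measurableSet_pastCyl m s)

/-- Almost surely every block recurs. -/
lemma ae_recurrent [IsProbabilityMeasure μ] (h : MeasurePreserving shift μ μ) :
    ∀ᵐ ω ∂μ, ∀ m u : ℕ, ∃ t : ℕ, 0 < t ∧ ∀ s < m,
      ω ((u : ℤ) - (s : ℤ) + (t : ℤ)) = ω ((u : ℤ) - (s : ℤ)) := by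
  have h0 : ∀ m : ℕ, ∀ᵐ ω ∂μ, ∃ t : ℕ, 0 < t ∧ ∀ s < m,
      ω (-(s : ℤ) + (t : ℤ)) = ω (-(s : ℤ)) := by
    intro m
    have : ∀ᵐ ω ∂μ, ∀ s : ℕ → 𝒳, ω ∈ cyl m s → ∃ t : ℕ, 0 < t ∧ tshift t ω ∈ cyl m s := by
      refine ae_forall_string m (fun ω s s' hs hp => by rwa [← cyl_congr hs]) fun s => ?_
      filter_upwards [h.conservative.ae_mem_imp_frequently_image_mem
        (measurableSet_cyl m s).nullMeasurableSet] with ω hω hmem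
      obtain ⟨t, ht, ht'⟩ := frequently_atTop.1 (hω hmem) 1
      rw [shift_iterate] at ht'
      exact ⟨t, ht, ht'⟩
    filter_upwards [this] with ω hω
    obtain ⟨t, ht, ht'⟩ := hω (past ω) fun j _ => rfl
    exact ⟨t, ht, fun s hs => ht' s hs⟩
  rw [ae_all_iff]
  intro m
  rw [ae_all_iff]
  intro u
  filter_upwards [(measurePreserving_tshift h u).quasiMeasurePreserving.ae (h0 m)] with ω ⟨t, ht, hω⟩
  refine ⟨t, ht, fun s hs => ?_⟩
  convert hω s hs using 1 <;> simp only [tshift] <;> congr 1 <;> ring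

/-- The waiting time for the recurrence of the block of length `m` ending at time `0`. -/
def recTime (m : ℕ) (ω : Path 𝒳) : ℕ :=
  sInf {t : ℕ | 0 < t ∧ ∀ s < m, ω (-(s : ℤ) + (t : ℤ)) = ω (-(s : ℤ))}

/-- The first return map of the cylinder of the current block of length `m`. -/
def returnMap (m : ℕ) (ω : Path 𝒳) : Path 𝒳 := tshift (recTime m ω) ω

lemma measurableSet_apply_eq {Ω : Type*} [MeasurableSpace Ω] {X Y : Ω → 𝒳} (hX : Measurable X)
    (hY : Measurable Y) : MeasurableSet {ω | X ω = Y ω} :=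
  measurableSet_eq_fun hX hY

lemma measurableSet_block_eq {Ω : Type*} [MeasurableSpace Ω] (m : ℕ) {X Y : ℕ → Ω → 𝒳}
    (hX : ∀ j, Measurable (X j)) (hY : ∀ j, Measurable (Y j)) :
    MeasurableSet {ω | ∀ j < m, X j ω = Y j ω} := by
  simp only [Set.ofPred_forall]
  exact MeasurableSet.iInter fun j => MeasurableSet.iInter fun _ =>
    measurableSet_apply_eq (hX j) (hY j)

lemma measurable_recTime (m : ℕ) : Measurable (recTime m : Path 𝒳 → ℕ) := by
  refine measurable_sInf_nat fun t => ?_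
  exact (MeasurableSet.const (0 < t)).inter (measurableSet_block_eq m
    (X := fun s (ω : Path 𝒳) => ω (-(s : ℤ) + (t : ℤ))) (Y := fun s (ω : Path 𝒳) => ω (-(s : ℤ)))
    (fun j => measurable_pi_apply _) fun j => measurable_pi_apply _)

lemma measurable_returnMap (m : ℕ) : Measurable (returnMap m : Path 𝒳 → Path 𝒳) :=
  measurable_apply_countable (h := fun (n : ℕ) ω => tshift (n : ℤ) ω) (measurable_recTime m)
    fun n => measurable_tshift n

/-- The first return map preserves the measure. -/
lemma measurePreserving_returnMap [IsProbabilityMeasure μ] (h : MeasurePreserving shift μ μ)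
    (m : ℕ) : MeasurePreserving (returnMap m) μ μ := by
  refine ⟨measurable_returnMap m, ?_⟩
  have : IsProbabilityMeasure (μ.map (returnMap m)) :=
    Measure.isProbabilityMeasure_map (measurable_returnMap m).aemeasurable
  refine Measure.eq_of_le_of_isProbabilityMeasure (Measure.le_iff.2 fun A hA => ?_)
  rw [Measure.map_apply (measurable_returnMap m) hA]
  let D : ℕ → Set (Path 𝒳) := fun t =>
    {ω | ∀ s < m, ω (-(s : ℤ)) = ω (-(s : ℤ) - ((t : ℤ) + 1))} ∩
      ⋂ r : ℕ, ⋂ (_ : 0 < r ∧ r < t + 1),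
        {ω | ∀ s < m, ω (-(s : ℤ) - ((t : ℤ) + 1) + r) = ω (-(s : ℤ) - ((t : ℤ) + 1))}ᶜ
  have hD : ∀ t, MeasurableSet (D t) := fun t =>
    (measurableSet_block_eq m (X := fun s (ω : Path 𝒳) => ω (-(s : ℤ)))
      (Y := fun s (ω : Path 𝒳) => ω (-(s : ℤ) - ((t : ℤ) + 1)))
      (fun j => measurable_pi_apply _) fun j => measurable_pi_apply _).inter
    (MeasurableSet.iInter fun r => MeasurableSet.iInter fun _ =>
      (measurableSet_block_eq m (X := fun s (ω : Path 𝒳) => ω (-(s : ℤ) - ((t : ℤ) + 1) + r))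
        (Y := fun s (ω : Path 𝒳) => ω (-(s : ℤ) - ((t : ℤ) + 1)))
        (fun j => measurable_pi_apply _) fun j => measurable_pi_apply _).compl)
  have hdisj : ∀ t t', t < t' → Disjoint (D t) (D t') := by
    intro t t' htt
    rw [Set.disjoint_left]
    rintro ω ⟨h1, -⟩ ⟨h1', h2'⟩
    obtain ⟨r, rfl⟩ := Nat.exists_eq_add_of_lt htt
    simp only [mem_iInter] at h2'
    refine h2' (r + 1) ⟨by omega, by omega⟩ fun s hs => ?_
    rw [← h1' s hs, h1 s hs]
    congr 1
    push_cast
    ring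
  have hsub : returnMap m ⁻¹' A ≤ᵐ[μ] ⋃ t : ℕ, tshift ((t + 1 : ℕ) : ℤ) ⁻¹' (D t ∩ A) := by
    filter_upwards [ae_recurrent h] with ω hω hmem
    have hne : {t : ℕ | 0 < t ∧ ∀ s < m, ω (-(s : ℤ) + (t : ℤ)) = ω (-(s : ℤ))}.Nonempty := by
      obtain ⟨t, ht, ht'⟩ := hω m 0
      exact ⟨t, ht, fun s hs => by simpa using ht' s hs⟩
    obtain ⟨hpos, heq⟩ := Nat.sInf_mem hne
    obtain ⟨t, ht⟩ := Nat.exists_eq_succ_of_ne_zero hpos.ne'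
    have hrec : recTime m ω = t + 1 := ht
    have heq' : ∀ s < m, ω (-(s : ℤ) + ((t + 1 : ℕ) : ℤ)) = ω (-(s : ℤ)) := by
      intro s hs
      have := heq s hs
      rwa [ht] at this
    refine mem_iUnion.2 ⟨t, ⟨fun s hs => ?_, ?_⟩, ?_⟩
    · simp only [tshift]
      rw [heq' s hs]
      congr 1
      push_cast
      ring
    · simp only [mem_iInter, mem_compl_iff]
      rintro r ⟨hr, hrt⟩ hall
      have : recTime m ω ≤ r := Nat.sInf_le ⟨hr, fun s hs => by
        have := hall s hs
        simp only [tshift] at this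
        convert this using 2 <;> push_cast <;> ring⟩
      omega
    · have : returnMap m ω ∈ A := hmem
      rwa [returnMap, hrec] at this
  calc μ (returnMap m ⁻¹' A) ≤ μ (⋃ t : ℕ, tshift ((t + 1 : ℕ) : ℤ) ⁻¹' (D t ∩ A)) :=
        measure_mono_ae hsub
    _ ≤ ∑' t : ℕ, μ (tshift ((t + 1 : ℕ) : ℤ) ⁻¹' (D t ∩ A)) := measure_iUnion_le _
    _ = ∑' t : ℕ, μ (D t ∩ A) := by
        congr 1 with t
        exact (measurePreserving_tshift h (t + 1)).measure_preimage
          ((hD t).inter hA).nullMeasurableSet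
    _ = μ (⋃ t, D t ∩ A) := by
        refine (measure_iUnion (fun t t' htt => ?_) fun t => (hD t).inter hA).symm
        refine Disjoint.mono inter_subset_left inter_subset_left ?_
        rcases lt_or_gt_of_ne htt with hlt | hlt
        · exact hdisj _ _ hlt
        · exact (hdisj _ _ hlt).symm
    _ ≤ μ A := measure_mono (iUnion_subset fun t => inter_subset_right)

end Recurrence

section Zeta

variable {l : ℕ → ℕ} {ω : Path 𝒳}

/-- All the recurrence times defining `zeta` are finite. -/
def IsGood (l : ℕ → ℕ) (ω : Path 𝒳) : Prop :=
  ∀ n, ∃ t : ℕ, 0 < t ∧ ∀ s < l (n + 1),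
    ω (zeta l ω n - (s : ℤ) + (t : ℤ)) = ω (zeta l ω n - (s : ℤ))

lemma zeta_nonneg (n : ℕ) : 0 ≤ zeta l ω n := by
  induction n with
  | zero => exact le_rfl
  | succ n ih => exact add_nonneg ih (Int.natCast_nonneg _)

lemma IsGood.exists_step (h : IsGood l ω) (n : ℕ) : ∃ t : ℕ, 0 < t ∧
    zeta l ω (n + 1) = zeta l ω n + t ∧
    (∀ s < l (n + 1), ω (zeta l ω n - (s : ℤ) + (t : ℤ)) = ω (zeta l ω n - (s : ℤ))) ∧
    ∀ r : ℕ, 0 < r → r < t →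
      ¬ ∀ s < l (n + 1), ω (zeta l ω n - (s : ℤ) + (r : ℤ)) = ω (zeta l ω n - (s : ℤ)) := by
  have hmem := Nat.sInf_mem (s := {t : ℕ | 0 < t ∧ ∀ s < l (n + 1),
          ω (zeta l ω n - (s : ℤ) + (t : ℤ)) = ω (zeta l ω n - (s : ℤ))}) (h n)
  refine ⟨_, hmem.1, rfl, hmem.2, fun r hr hlt hall => ?_⟩
  exact Nat.notMem_of_lt_sInf hlt ⟨hr, hall⟩

lemma IsGood.zeta_lt_succ (h : IsGood l ω) (n : ℕ) : zeta l ω n < zeta l ω (n + 1) := by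
  obtain ⟨t, ht, he, -⟩ := h.exists_step n
  omega

lemma IsGood.strictMono (h : IsGood l ω) : StrictMono (zeta l ω) :=
  strictMono_nat_of_lt_succ h.zeta_lt_succ

lemma IsGood.le_zeta (h : IsGood l ω) (n : ℕ) : (n : ℤ) ≤ zeta l ω n := by
  induction n with
  | zero => exact le_rfl
  | succ n ih => have := h.zeta_lt_succ n; push_cast; omega

lemma IsGood.apply_zeta_sub (h : IsGood l ω) (hl : Monotone l) {n n' i : ℕ} (hn : n ≤ n')
    (hi : i < l (n + 1)) : ω (zeta l ω n' - i) = ω (zeta l ω n - i) := by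
  induction n', hn using Nat.le_induction with
  | base => rfl
  | succ k hk ih =>
    obtain ⟨t, -, he, heq, -⟩ := h.exists_step k
    rw [← ih, ← heq i (hi.trans_le (hl (by omega))), he]
    congr 1
    ring

lemma Jfun_spec (hl : Tendsto l atTop atTop) (i : ℕ) : 1 ≤ Jfun l i ∧ i < l (Jfun l i + 1) := by
  refine Nat.sInf_mem (s := {j : ℕ | 1 ≤ j ∧ i < l (j + 1)}) ?_
  obtain ⟨j, h1, h2⟩ := ((((tendsto_add_atTop_iff_nat 1).2 hl).eventually_gt_atTop i).and
    (eventually_ge_atTop 1)).exists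
  exact ⟨j, h2, h1⟩

lemma Jfun_le {i n : ℕ} (hn : 1 ≤ n) (h : i < l (n + 1)) : Jfun l i ≤ n := Nat.sInf_le ⟨hn, h⟩

lemma Jfun_mono (hl : Tendsto l atTop atTop) {i k : ℕ} (h : i ≤ k) : Jfun l i ≤ Jfun l k :=
  Jfun_le (Jfun_spec hl k).1 (h.trans_lt (Jfun_spec hl k).2)

lemma IsGood.tildePast_eq (h : IsGood l ω) (hl : Monotone l) (hl' : Tendsto l atTop atTop)
    {n i : ℕ} (hn : 1 ≤ n) (hi : i < l (n + 1)) : tildePast l ω i = ω (zeta l ω n - i) :=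
  (h.apply_zeta_sub hl (Jfun_le hn hi) (Jfun_spec hl' i).2).symm

lemma zeta_succ (n : ℕ) : zeta l ω (n + 1) =
    zeta l ω n + recTime (l (n + 1)) (tshift (zeta l ω n) ω) := by
  simp only [zeta, recTime, tshift]
  have : ∀ (s t : ℕ), ω (-(s : ℤ) + t + zeta l ω n) = ω (zeta l ω n - s + t) := fun s t => by
    congr 1; ring
  have h2 : ∀ s : ℕ, ω (-(s : ℤ) + zeta l ω n) = ω (zeta l ω n - s) := fun s => by
    congr 1; ring
  simp_rw [this, h2]

lemma tshift_zeta_succ (n : ℕ) : tshift (zeta l ω (n + 1)) ω =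
    returnMap (l (n + 1)) (tshift (zeta l ω n) ω) := by
  funext i
  rw [zeta_succ]
  simp only [returnMap, tshift]
  congr 1
  ring

variable [Countable 𝒳] [MeasurableSingletonClass 𝒳]

lemma measurable_zeta (l : ℕ → ℕ) (n : ℕ) : Measurable fun ω : Path 𝒳 => zeta l ω n := by
  induction n with
  | zero => exact measurable_const
  | succ n ih =>
    simp_rw [zeta_succ]
    exact measurable_apply_countable
      (h := fun (z : ℤ) ω => z + (recTime (l (n + 1)) (tshift z ω) : ℤ)) ih
      fun z => measurable_const.add
        (measurable_from_nat.comp ((measurable_recTime _).comp (measurable_tshift z)))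

lemma measurable_apply_int {Ω : Type*} [MeasurableSpace Ω] {X : Ω → Path 𝒳} (hX : Measurable X)
    {N : Ω → ℤ} (hN : Measurable N) : Measurable fun ω => X ω (N ω) :=
  measurable_apply_countable (h := fun (z : ℤ) ω => X ω z) hN fun z =>
    (measurable_pi_apply z).comp hX

lemma measurable_tildePast (l : ℕ → ℕ) : Measurable (tildePast l : Path 𝒳 → ℕ → 𝒳) :=
  measurable_pi_lambda _ fun _ =>
    measurable_apply_int measurable_id ((measurable_zeta l _).sub_const _)

variable {μ : Measure (Path 𝒳)} [IsProbabilityMeasure μ]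

lemma ae_isGood (h : MeasurePreserving shift μ μ) (l : ℕ → ℕ) : ∀ᵐ ω ∂μ, IsGood l ω := by
  filter_upwards [ae_recurrent h] with ω hω n
  obtain ⟨u, hu⟩ := Int.eq_ofNat_of_zero_le (zeta_nonneg (l := l) (ω := ω) n)
  rw [hu]
  exact hω _ u

lemma measurePreserving_tshift_zeta (h : MeasurePreserving shift μ μ) (l : ℕ → ℕ) (n : ℕ) :
    MeasurePreserving (fun ω => tshift (zeta l ω n) ω) μ μ := by
  induction n with
  | zero =>
    have : (fun ω : Path 𝒳 => tshift (zeta l ω 0) ω) = id := by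
      funext ω i; simp [tshift, zeta]
    rw [this]
    exact MeasurePreserving.id μ
  | succ n ih =>
    simp_rw [tshift_zeta_succ]
    exact (measurePreserving_returnMap h _).comp ih

/-- The auxiliary process has the same law as the past of the original process. -/
lemma map_tildePast (h : MeasurePreserving shift μ μ) (hl : Monotone l)
    (hl' : Tendsto l atTop atTop) : μ.map (tildePast l) = μ.map past := by
  refine measure_ext_pastCyl ?_ fun m s => ?_
  · rw [Measure.map_apply (measurable_tildePast l) .univ, Measure.map_apply measurable_past .univ]
    rfl
  · rw [Measure.map_apply (measurable_tildePast l) (measurableSet_pastCyl m s),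
      Measure.map_apply measurable_past (measurableSet_pastCyl m s)]
    obtain ⟨n, h1, h2⟩ := ((((tendsto_add_atTop_iff_nat 1).2 hl').eventually_ge_atTop m).and
      (eventually_ge_atTop 1)).exists
    rw [← (measurePreserving_tshift_zeta h l n).measure_preimage
      (measurable_past (measurableSet_pastCyl m s)).nullMeasurableSet]
    refine measure_congr (Filter.eventuallyEq_set.2 ?_)
    filter_upwards [ae_isGood h l] with ω hω
    refine forall₂_congr fun j hj => ?_
    rw [hω.tildePast_eq hl hl' h2 (hj.trans_le h1)]
    simp only [past, tshift]
    rw [show -(j : ℤ) + zeta l ω n = zeta l ω n - j by ring]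

/-- A property of one-sided sequences which holds almost surely for the past also holds almost
surely for the auxiliary process, even if it is not measurable. -/
lemma ae_tildePast_of_ae_past (h : MeasurePreserving shift μ μ) (hl : Monotone l)
    (hl' : Tendsto l atTop atTop) {p : (ℕ → 𝒳) → Prop} (hp : ∀ᵐ ω ∂μ, p (past ω)) :
    ∀ᵐ ω ∂μ, p (tildePast l ω) := by
  have : Nonempty (Path 𝒳) := nonempty_of_isProbabilityMeasure μ
  have hjoint : Measurable fun ω : Path 𝒳 => (past ω, ω) := measurable_past.prodMk measurable_id
  set ρ : Measure ((ℕ → 𝒳) × Path 𝒳) := μ.map fun ω => (past ω, ω) with hρ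
  have hρp : IsProbabilityMeasure ρ := Measure.isProbabilityMeasure_map hjoint.aemeasurable
  have hfst : ρ.fst = μ.map past := by
    exact Measure.fst_map_prodMk (Y := fun ω : Path 𝒳 => ω) measurable_id
  have h1 : ∀ᵐ q ∂ρ, past q.2 = q.1 := by
    exact (ae_map_iff hjoint.aemeasurable (measurableSet_eq_fun
      (f := fun q : (ℕ → 𝒳) × Path 𝒳 => past q.2)
      (measurable_past.comp measurable_snd) measurable_fst)).2 (ae_of_all _ fun ω => rfl)
  have h2 : ∀ᵐ q ∂ρ, p (past q.2) := by
    have hsnd : μ = ρ.map Prod.snd := by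
      rw [hρ, Measure.map_map measurable_snd hjoint]
      exact Measure.map_id.symm
    rw [hsnd] at hp
    exact ae_of_ae_map measurable_snd.aemeasurable hp
  rw [← ρ.disintegrate ρ.condKernel] at h1 h2
  have h3 : ∀ᵐ a ∂ρ.fst, p a := by
    filter_upwards [Measure.ae_ae_of_ae_compProd h1, Measure.ae_ae_of_ae_compProd h2] with a ha hb
    obtain ⟨ω, h1, h2⟩ := (ha.and hb).exists
    rwa [← show past ω = a from h1]
  rw [hfst, ← map_tildePast h hl hl'] at h3
  exact ae_of_ae_map (measurable_tildePast l).aemeasurable h3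

end Zeta

section Causality

variable {l : ℕ → ℕ} {ω ω' : Path 𝒳} {β γ : ℝ}

lemma prependOld_congr {k : ℕ} {b b' : ℕ → 𝒳} (h : ∀ j < k, b j = b' j) (z : ℕ → 𝒳) :
    prependOld b k z = prependOld b' k z := by
  funext j
  unfold prependOld
  split_ifs with hj
  · exact h j hj
  · rfl

lemma withLast_congr {k : ℕ} {b b' : ℕ → 𝒳} (h : ∀ j < k, b j = b' j) (x : 𝒳) :
    ∀ j < k + 1, withLast x b j = withLast x b' j := by
  intro j hj
  unfold withLast
  split_ifs with h0
  · rfl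
  · exact h _ (by omega)

lemma occursAt_congr {m : ℕ} {s s' : ℕ → 𝒳} {t : ℤ} (hs : ∀ j < m, s j = s' j)
    (hω : ∀ j < m, ω (t - (j : ℤ)) = ω' (t - (j : ℤ))) : OccursAt ω m s t ↔ OccursAt ω' m s' t :=
  forall₂_congr fun j hj => by rw [hs j hj, hω j hj]

lemma cnt_congr {m : ℕ} {s s' : ℕ → 𝒳} {a b : ℤ}
    (h : ∀ t, a ≤ t → t ≤ b → (OccursAt ω m s t ↔ OccursAt ω' m s' t)) :
    cnt ω m s a b = cnt ω' m s' a b := by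
  refine congrArg Finset.card (Finset.ext fun t => ?_)
  simp only [Finset.mem_filter, Finset.mem_Icc]
  exact and_congr_right fun ht => h t ht.1 ht.2

lemma half_le (n : ℕ) : half n ≤ n := by unfold half; omega

lemma empCond_congr {n m : ℕ} {x : 𝒳} {s s' : ℕ → 𝒳} (hs : ∀ j < m, s j = s' j)
    (hω : ∀ i : ℤ, 0 ≤ i → i ≤ n → ω i = ω' i) : empCond ω n m x s = empCond ω' n m x s' := by
  unfold empCond
  congr 2
  · refine cnt_congr fun t h1 h2 => occursAt_congr (withLast_congr hs x) fun j hj => ?_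
    exact hω _ (by omega) (by omega)
  · refine cnt_congr fun t h1 h2 => occursAt_congr hs fun j hj => ?_
    exact hω _ (by omega) (by omega)

lemma inL_congr {n m : ℕ} {s : ℕ → 𝒳} (hω : ∀ i : ℤ, 0 ≤ i → i ≤ n → ω i = ω' i) :
    inL γ ω n m s ↔ inL γ ω' n m s := by
  have hn := half_le n
  unfold inL inL1 inL2
  refine and_congr (exists_congr fun t => and_congr_right fun h1 => and_congr_right fun h2 => ?_) ?_
  · refine occursAt_congr (fun _ _ => rfl) fun j hj => hω _ (by omega) (by omega)
  · rw [cnt_congr fun t h1 h2 => occursAt_congr (fun _ _ => rfl) fun j hj =>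
      hω _ (by omega) (by omega)]

lemma hatDelta_congr {n k : ℕ} (hω : ∀ i : ℤ, 0 ≤ i → i ≤ n → ω i = ω' i)
    (hz : zeta l ω (Jfun l k) ≤ (half n : ℤ) - 1 ↔ zeta l ω' (Jfun l k) ≤ (half n : ℤ) - 1)
    (ht : zeta l ω (Jfun l k) ≤ (half n : ℤ) - 1 →
      ∀ j < k, tildePast l ω j = tildePast l ω' j) :
    hatDelta γ l ω n k = hatDelta γ l ω' n k := by
  unfold hatDelta
  by_cases h : zeta l ω (Jfun l k) ≤ (half n : ℤ) - 1
  · have h' := hz.1 h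
    rw [if_pos h, if_pos h']
    congr 2
    ext d
    refine exists_congr fun i => and_congr_right fun _ => and_congr_right fun _ =>
      exists_congr fun z => exists_congr fun x => ?_
    rw [prependOld_congr (ht h) z, inL_congr hω, empCond_congr (ht h) hω,
      empCond_congr (fun _ _ => rfl) hω]
  · rw [if_neg h, if_neg (hz.not.1 h), zero_mul, zero_mul]

lemma IsGood.zeta_causal (hll : ∀ k, 1 ≤ k → l k ≤ k) (h : IsGood l ω) (h' : IsGood l ω') {t : ℤ}
    (hω : ∀ i, 0 ≤ i → i ≤ t → ω i = ω' i) {n : ℕ} (hn : zeta l ω n ≤ t) : zeta l ω' n = zeta l ω n := by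
  induction n with
  | zero => rfl
  | succ n ih =>
    have hlt := h.zeta_lt_succ n
    have hz := ih (hlt.le.trans hn)
    obtain ⟨a, ha, hae, hab, ham⟩ := h.exists_step n
    obtain ⟨a', ha', hae', hab', ham'⟩ := h'.exists_step n
    rw [hz] at hae' hab' ham'
    have key : ∀ r : ℕ, r ≤ a → ((∀ s < l (n + 1),
        ω (zeta l ω n - (s : ℤ) + (r : ℤ)) = ω (zeta l ω n - (s : ℤ))) ↔ ∀ s < l (n + 1),
        ω' (zeta l ω n - (s : ℤ) + (r : ℤ)) = ω' (zeta l ω n - (s : ℤ))) := fun r hr =>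
      forall₂_congr fun s hs => by
        have h1 := hll (n + 1) (by omega)
        have h2 := h.le_zeta n
        rw [hω _ (by omega) (by omega), hω _ (by omega) (by omega)]
    rcases lt_trichotomy a a' with hlt | heq | hlt
    · exact absurd ((key a le_rfl).1 hab) (ham' a ha hlt)
    · omega
    · exact absurd ((key a' hlt.le).2 hab') (ham a' ha' hlt)

lemma IsGood.zeta_le_iff (hll : ∀ k, 1 ≤ k → l k ≤ k) (h : IsGood l ω) (h' : IsGood l ω') {t : ℤ}
    (hω : ∀ i, 0 ≤ i → i ≤ t → ω i = ω' i) {n : ℕ} {u : ℤ} (hu : u ≤ t) :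
    zeta l ω n ≤ u ↔ zeta l ω' n ≤ u := by
  constructor
  · intro hn
    rwa [h.zeta_causal hll h' hω (hn.trans hu)]
  · intro hn
    rwa [h'.zeta_causal hll h (fun i h0 hi => (hω i h0 hi).symm) (hn.trans hu)]

lemma IsGood.chi_causal (hll : ∀ k, 1 ≤ k → l k ≤ k) (hl' : Tendsto l atTop atTop) (h : IsGood l ω) (h' : IsGood l ω') {t : ℤ}
    (hω : ∀ i, 0 ≤ i → i ≤ t → ω i = ω' i) {n : ℕ} (hn : (n : ℤ) ≤ t) :
    chi β γ l ω n = chi β γ l ω' n := by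
  have hhalf := half_le n
  have : ∀ k, hatDelta γ l ω n k = hatDelta γ l ω' n k := fun k => by
    refine hatDelta_congr (fun i h0 hi => hω i h0 (by omega))
      (h.zeta_le_iff hll h' hω (by omega)) fun hz j hj => ?_
    have hJ : zeta l ω (Jfun l j) ≤ t :=
      (h.strictMono.monotone (Jfun_mono hl' hj.le)).trans (hz.trans (by omega))
    unfold tildePast
    have h1 := (Jfun_spec hl' j).2
    have h2 := hll (Jfun l j + 1) (by omega)
    have h3 := h.le_zeta (Jfun l j)
    rw [h.zeta_causal hll h' hω hJ, hω _ (by omega) (by omega)]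
  unfold chi
  simp_rw [this]

lemma hatDelta_pred {n : ℕ} (hn : 1 ≤ n) : hatDelta γ l ω n (n - 1) = 0 := by
  have hhalf := half_le n
  unfold hatDelta
  refine mul_eq_zero_of_right _ ?_
  convert Real.sSup_empty
  rw [Set.eq_empty_iff_forall_notMem]
  rintro d ⟨i, hi, -, z, x, ⟨⟨t, h1, h2, -⟩, -⟩, -⟩
  omega

lemma chi_le {n k : ℕ} (hk : k < n) (h : hatDelta γ l ω n k ≤ (n : ℝ) ^ (-β)) :
    chi β γ l ω n ≤ k := Nat.sInf_le ⟨hk, h⟩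

lemma chi_mem {n : ℕ} (hn : 1 ≤ n) : chi β γ l ω n < n ∧
    hatDelta γ l ω n (chi β γ l ω n) ≤ (n : ℝ) ^ (-β) := by
  refine Nat.sInf_mem (s := {k : ℕ | k < n ∧ hatDelta γ l ω n k ≤ (n : ℝ) ^ (-β)})
    ⟨n - 1, by omega, ?_⟩
  rw [hatDelta_pred hn]
  positivity

lemma IsGood.chi_le_block (hl : Monotone l) (hl' : Tendsto l atTop atTop) (h : IsGood l ω)
    {n i : ℕ} (hn : 1 ≤ n) (hi : (n : ℤ) ≤ zeta l ω (i + 1)) : chi β γ l ω n ≤ l (i + 1) := by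
  have hhalf := half_le n
  by_cases hln : l (i + 1) < n
  · refine chi_le hln ?_
    have hJ : i + 1 ≤ Jfun l (l (i + 1)) := by
      by_contra! hlt
      exact absurd (hl (show Jfun l (l (i + 1)) + 1 ≤ i + 1 by omega))
        (not_le.2 (Jfun_spec hl' (l (i + 1))).2)
    have hz := h.strictMono.monotone hJ
    unfold hatDelta
    rw [if_neg (by omega), zero_mul]
    positivity
  · have := (chi_mem (β := β) (γ := γ) (l := l) (ω := ω) hn).1
    omega

lemma lambda_lt_succ (n : ℕ) : lambda β γ l ω n < lambda β γ l ω (n + 1) := by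
  rw [lambda]
  have := Int.natCast_nonneg (sInf {s : ℕ |
          ∀ r < chi β γ l ω (lambda β γ l ω n + 1 + (s : ℤ)).toNat,
            ω (lambda β γ l ω n + 1 + (s : ℤ) - (r : ℤ)) =
              ω (zeta l ω (jIndex l ω (lambda β γ l ω n)) - (r : ℤ))})
  omega

lemma le_lambda (n : ℕ) : (n : ℤ) ≤ lambda β γ l ω n := by
  induction n with
  | zero => exact le_rfl
  | succ n ih => have := lambda_lt_succ (β := β) (γ := γ) (l := l) (ω := ω) n; push_cast; omega

lemma lambda_nonneg (n : ℕ) : 0 ≤ lambda β γ l ω n := (Int.natCast_nonneg n).trans (le_lambda n)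

lemma IsGood.jIndex_spec (h : IsGood l ω) {v : ℤ} (hv : 0 ≤ v) :
    zeta l ω (jIndex l ω v) ≤ v ∧ v < zeta l ω (jIndex l ω v + 1) := by
  have hmem := Nat.sInf_mem (s := {j : ℕ | v < zeta l ω (j + 1)})
    ⟨v.toNat, by have := h.le_zeta (v.toNat + 1); simp only [mem_ofPred_eq]; omega⟩
  refine ⟨?_, hmem⟩
  rcases Nat.eq_zero_or_pos (jIndex l ω v) with h0 | h0
  · rw [h0]; exact hv
  · have : jIndex l ω v - 1 ∉ {j : ℕ | v < zeta l ω (j + 1)} :=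
      Nat.notMem_of_lt_sInf (by change _ < jIndex l ω v; omega)
    simpa [Nat.sub_add_cancel h0] using this

lemma IsGood.jIndex_eq (h : IsGood l ω) {v : ℤ} {j : ℕ} (h1 : zeta l ω j ≤ v)
    (h2 : v < zeta l ω (j + 1)) : jIndex l ω v = j := by
  obtain ⟨h3, h4⟩ := h.jIndex_spec ((zeta_nonneg j).trans h1)
  have h5 := h.strictMono.lt_iff_lt.1 (h1.trans_lt h4)
  have h6 := h.strictMono.lt_iff_lt.1 (h3.trans_lt h2)
  omega

lemma IsGood.mem_lambda_set (hl : Monotone l) (hl' : Tendsto l atTop atTop) (h : IsGood l ω)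
    (n : ℕ) : (zeta l ω (jIndex l ω (lambda β γ l ω n) + 1) - lambda β γ l ω n - 1).toNat ∈ {s : ℕ | ∀ r < chi β γ l ω (lambda β γ l ω n + 1 + (s : ℤ)).toNat,
      ω (lambda β γ l ω n + 1 + (s : ℤ) - (r : ℤ)) =
        ω (zeta l ω (jIndex l ω (lambda β γ l ω n)) - (r : ℤ))} := by
  set v := lambda β γ l ω n
  obtain ⟨-, h2⟩ := h.jIndex_spec (lambda_nonneg (β := β) (γ := γ) (l := l) (ω := ω) n)
  set i := jIndex l ω v
  have hv : 0 ≤ v := lambda_nonneg n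
  intro r hr
  have he : v + 1 + ((zeta l ω (i + 1) - v - 1).toNat : ℤ) = zeta l ω (i + 1) := by omega
  rw [he] at hr ⊢
  exact h.apply_zeta_sub hl (by omega) (hr.trans_le (h.chi_le_block hl hl' (by omega) (by omega)))

/-- At time `λ_{n+1}` the last `χ` symbols repeat the block ending at the preceding `ζ`. -/
lemma IsGood.lambda_succ_spec (hl : Monotone l) (hl' : Tendsto l atTop atTop) (h : IsGood l ω)
    (n : ℕ) : ∀ r < chi β γ l ω (lambda β γ l ω (n + 1)).toNat,
      ω (lambda β γ l ω (n + 1) - (r : ℤ)) =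
        ω (zeta l ω (jIndex l ω (lambda β γ l ω n)) - (r : ℤ)) :=
  Nat.sInf_mem ⟨_, h.mem_lambda_set hl hl' n⟩

lemma IsGood.lambda_causal (hll : ∀ k, 1 ≤ k → l k ≤ k) (hl : Monotone l) (hl' : Tendsto l atTop atTop) (h : IsGood l ω)
    (h' : IsGood l ω') {t : ℤ} (hω : ∀ i, 0 ≤ i → i ≤ t → ω i = ω' i) {n : ℕ} (hn : lambda β γ l ω n ≤ t) :
    lambda β γ l ω' n = lambda β γ l ω n := by
  induction n with
  | zero => rfl
  | succ n ih =>
    have hlt := lambda_lt_succ (β := β) (γ := γ) (l := l) (ω := ω) n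
    have hv := ih (hlt.le.trans hn)
    have h0 := lambda_nonneg (β := β) (γ := γ) (l := l) (ω := ω) n
    obtain ⟨h1, h2⟩ := h.jIndex_spec h0
    set v := lambda β γ l ω n with hvdef
    set i := jIndex l ω v with hidef
    have hz : zeta l ω' i = zeta l ω i := h.zeta_causal hll h' hω (by omega)
    have hi : jIndex l ω' v = i := by
      refine h'.jIndex_eq (by omega) ?_
      by_contra! hle
      exact absurd ((h.zeta_le_iff hll h' hω (by omega)).2 hle) (not_le.2 h2)
    have key : ∀ s : ℕ, v + 1 + (s : ℤ) ≤ t → v + 1 + (s : ℤ) ≤ zeta l ω (i + 1) →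
        ((∀ r < chi β γ l ω (v + 1 + (s : ℤ)).toNat,
            ω (v + 1 + (s : ℤ) - (r : ℤ)) = ω (zeta l ω i - (r : ℤ))) ↔
          ∀ r < chi β γ l ω' (v + 1 + (s : ℤ)).toNat,
            ω' (v + 1 + (s : ℤ) - (r : ℤ)) = ω' (zeta l ω i - (r : ℤ))) := fun s hs hs' => by
      have hc1 := h.chi_le_block (β := β) (γ := γ) hl hl' (n := (v + 1 + (s : ℤ)).toNat)
        (i := i) (by omega) (by omega)
      have hc2 := (chi_mem (β := β) (γ := γ) (l := l) (ω := ω)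
        (n := (v + 1 + (s : ℤ)).toNat) (by omega)).1
      have hc3 := hll (i + 1) (by omega)
      have hc4 := h.le_zeta i
      rw [← h.chi_causal hll hl' h' hω (by omega)]
      exact forall₂_congr fun r hr => by
        rw [hω _ (by omega) (by omega), hω _ (by omega) (by omega)]
    have hmem := Nat.sInf_mem ⟨_, h.mem_lambda_set (β := β) (γ := γ) hl hl' n⟩
    have hmem' := Nat.sInf_mem ⟨_, h'.mem_lambda_set (β := β) (γ := γ) hl hl' n⟩
    have hle := Nat.sInf_le (h.mem_lambda_set (β := β) (γ := γ) hl hl' n)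
    have hmin := fun s => Nat.notMem_of_lt_sInf (m := s) (s := {s : ℕ |
      ∀ r < chi β γ l ω (lambda β γ l ω n + 1 + (s : ℤ)).toNat,
        ω (lambda β γ l ω n + 1 + (s : ℤ) - (r : ℤ)) =
        ω (zeta l ω (jIndex l ω (lambda β γ l ω n)) - (r : ℤ))})
    have hmin' := fun s => Nat.notMem_of_lt_sInf (m := s) (s := {s : ℕ |
      ∀ r < chi β γ l ω' (lambda β γ l ω' n + 1 + (s : ℤ)).toNat,
        ω' (lambda β γ l ω' n + 1 + (s : ℤ) - (r : ℤ)) =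
        ω' (zeta l ω' (jIndex l ω' (lambda β γ l ω' n)) - (r : ℤ))})
    rw [lambda] at hn ⊢
    rw [lambda]
    rw [hv, hi, hz] at hmem' hmin' ⊢
    rw [← hvdef, ← hidef] at hmem hmin hn hle ⊢
    generalize sInf {s : ℕ | ∀ r < chi β γ l ω (v + 1 + (s : ℤ)).toNat,
      ω (v + 1 + (s : ℤ) - (r : ℤ)) = ω (zeta l ω i - (r : ℤ))} = a at *
    generalize sInf {s : ℕ | ∀ r < chi β γ l ω' (v + 1 + (s : ℤ)).toNat,
      ω' (v + 1 + (s : ℤ) - (r : ℤ)) = ω' (zeta l ω i - (r : ℤ))} = a' at *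
    rcases lt_trichotomy a a' with hlt' | heq | hlt'
    · exact absurd ((key a hn (by omega)).1 hmem) (hmin' a hlt')
    · omega
    · exact absurd ((key a' (by omega) (by omega)).2 hmem') (hmin a' hlt')

variable [Countable 𝒳] [MeasurableSingletonClass 𝒳]

lemma measurable_hatDelta (γ : ℝ) (l : ℕ → ℕ) (n k : ℕ) :
    Measurable fun ω : Path 𝒳 => hatDelta γ l ω n k := by
  refine measurable_of_factors (φ := fun ω : Path 𝒳 => (zeta l ω (Jfun l k),
    (fun j : Fin k => tildePast l ω j), fun i : Fin (n + 1) => ω ((i : ℕ) : ℤ))) ?_ ?_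
  · have h1 : Measurable fun (ω : Path 𝒳) (j : Fin k) => tildePast l ω j :=
      measurable_pi_lambda _ fun j => (measurable_pi_iff.1 (measurable_tildePast l)) j
    have h2 : Measurable fun (ω : Path 𝒳) (i : Fin (n + 1)) => ω ((i : ℕ) : ℤ) :=
      measurable_pi_lambda _ fun i => measurable_pi_apply _
    exact (measurable_zeta l _).prodMk (h1.prodMk h2)
  · intro ω ω' h
    simp only [Prod.mk.injEq] at h
    obtain ⟨h1, h2, h3⟩ := h
    refine hatDelta_congr (fun i h0 hi => ?_) (by rw [h1]) fun _ j hj => congrFun h2 ⟨j, hj⟩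
    have := congrFun h3 ⟨i.toNat, by omega⟩
    simpa [Int.toNat_of_nonneg h0] using this

lemma measurable_chi (β γ : ℝ) (l : ℕ → ℕ) (n : ℕ) :
    Measurable fun ω : Path 𝒳 => chi β γ l ω n :=
  measurable_sInf_nat fun k => (MeasurableSet.const (k < n)).inter
    (measurableSet_le (measurable_hatDelta γ l n k) measurable_const)

lemma measurable_jIndex (l : ℕ → ℕ) (v : ℤ) : Measurable fun ω : Path 𝒳 => jIndex l ω v :=
  measurable_sInf_nat fun j => measurableSet_lt measurable_const (measurable_zeta l (j + 1))

lemma measurable_lambda (β γ : ℝ) (l : ℕ → ℕ) (n : ℕ) :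
    Measurable fun ω : Path 𝒳 => lambda β γ l ω n := by
  induction n with
  | zero => exact measurable_const
  | succ n ih =>
    simp_rw [lambda]
    refine measurable_apply_countable (h := fun (v : ℤ) (ω : Path 𝒳) => v + 1 +
      ((sInf {s : ℕ | ∀ r < chi β γ l ω (v + 1 + (s : ℤ)).toNat,
        ω (v + 1 + (s : ℤ) - (r : ℤ)) = ω (zeta l ω (jIndex l ω v) - (r : ℤ))} : ℕ) : ℤ)) ih
      fun v => measurable_const.add (measurable_from_nat.comp (measurable_sInf_nat fun s => ?_))
    simp only [Set.ofPred_forall]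
    refine MeasurableSet.iInter fun r => ?_
    have h1 : MeasurableSet {ω : Path 𝒳 | r < chi β γ l ω (v + 1 + (s : ℤ)).toNat} :=
      measurableSet_lt measurable_const (measurable_chi β γ l _)
    have h2 : MeasurableSet {ω : Path 𝒳 |
        ω (v + 1 + (s : ℤ) - (r : ℤ)) = ω (zeta l ω (jIndex l ω v) - (r : ℤ))} :=
      measurableSet_apply_eq (measurable_pi_apply _) (measurable_apply_int measurable_id
        ((measurable_apply_countable (h := fun i (ω : Path 𝒳) => zeta l ω i)
          (measurable_jIndex l v) (measurable_zeta l)).sub_const _))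
    convert! h1.compl.union h2 using 1
    ext ω
    simp only [mem_union, mem_compl_iff, mem_ofPred_eq]
    exact imp_iff_not_or

end Causality

section Memory

variable {μ : Measure (Path 𝒳)}

lemma pstr_eq (m : ℕ) (s : ℕ → 𝒳) : pstr μ m s = (μ (cyl m s)).toReal := rfl

lemma pcond_eq (m : ℕ) (y : 𝒳) (s : ℕ → 𝒳) :
    pcond μ m y s = (μ ({ω | ω 1 = y} ∩ cyl m s)).toReal / (μ (cyl m s)).toReal := rfl

lemma pcond_congr {m : ℕ} {s s' : ℕ → 𝒳} (h : ∀ j < m, s j = s' j) (y : 𝒳) :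
    pcond μ m y s = pcond μ m y s' := by
  rw [pcond_eq, pcond_eq, cyl_congr h]

lemma isMemoryBound_congr {K : ℕ} {b b' : ℕ → 𝒳} (h : ∀ j < K, b j = b' j)
    (hb : IsMemoryBound μ b K) : IsMemoryBound μ b' K := by
  intro i hi y z hz
  rw [← prependOld_congr h] at hz ⊢
  rw [← pcond_congr h]
  exact hb i hi y z hz

lemma prependOld_tail (k : ℕ) (s : ℕ → 𝒳) : prependOld s k (fun j => s (j + k)) = s := by
  funext j
  unfold prependOld
  split_ifs with hj
  · rfl
  · exact congrArg s (Nat.sub_add_cancel (not_lt.1 hj))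

lemma cyl_anti {m n : ℕ} (h : m ≤ n) (s : ℕ → 𝒳) : cyl n s ⊆ cyl m s :=
  fun _ hω j hj => hω j (hj.trans_le h)

variable [Countable 𝒳] [MeasurableSingletonClass 𝒳]

lemma measure_le_of_singleton {ν₁ ν₂ : Measure 𝒳} (h : ∀ y, ν₁ {y} ≤ ν₂ {y}) : ν₁ ≤ ν₂ := by
  rw [← Measure.sum_smul_dirac ν₁, ← Measure.sum_smul_dirac ν₂]
  refine Measure.le_iff.2 fun A hA => ?_
  rw [Measure.sum_apply _ hA, Measure.sum_apply _ hA]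
  refine ENNReal.tsum_le_tsum fun y => ?_
  simp only [Measure.smul_apply, smul_eq_mul]
  exact mul_le_mul' (h y) le_rfl

lemma shift_preimage_cyl_withLast (m : ℕ) (y : 𝒳) (s : ℕ → 𝒳) :
    shift ⁻¹' cyl (m + 1) (withLast y s) = {ω | ω 1 = y} ∩ cyl m s := by
  ext ω
  simp only [mem_preimage, mem_cyl, shift, withLast, mem_inter_iff, mem_ofPred_eq]
  constructor
  · intro h
    refine ⟨by simpa using h 0 (by omega), fun j hj => ?_⟩
    have := h (j + 1) (by omega)
    rw [if_neg (by omega)] at this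
    convert! this using 2
    push_cast; ring
  · rintro ⟨h1, h2⟩ j hj
    rcases Nat.eq_zero_or_pos j with rfl | h0
    · simpa using h1
    · rw [if_neg (by omega), ← h2 (j - 1) (by omega)]
      congr 1
      omega

lemma pstr_withLast (hT : MeasurePreserving shift μ μ) (m : ℕ) (y : 𝒳) (s : ℕ → 𝒳) :
    pstr μ (m + 1) (withLast y s) = (μ ({ω | ω 1 = y} ∩ cyl m s)).toReal := by
  rw [pstr_eq, ← hT.measure_preimage (measurableSet_cyl _ _).nullMeasurableSet,
    shift_preimage_cyl_withLast]

variable [IsProbabilityMeasure μ]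

lemma measure_next_inter_cyl_of_isMemoryBound (hT : MeasurePreserving shift μ μ) {b : ℕ → 𝒳}
    {K : ℕ} (hb : IsMemoryBound μ b K) {m : ℕ} {s : ℕ → 𝒳} (hm : K < m)
    (hs : ∀ j < K, s j = b j) (Y : Set 𝒳) :
    μ (cyl K b) * μ ((fun ω => ω 1) ⁻¹' Y ∩ cyl m s) =
      μ (cyl m s) * μ ((fun ω => ω 1) ⁻¹' Y ∩ cyl K b) := by
  have hX : Measurable fun ω : Path 𝒳 => ω 1 := measurable_pi_apply (1 : ℤ)
  set ν₁ : Measure 𝒳 := μ (cyl K b) • (μ.restrict (cyl m s)).map fun ω => ω 1 with hν₁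
  set ν₂ : Measure 𝒳 := μ (cyl m s) • (μ.restrict (cyl K b)).map fun ω => ω 1 with hν₂
  have e₁ : ∀ Y : Set 𝒳, ν₁ Y = μ (cyl K b) * μ ((fun ω => ω 1) ⁻¹' Y ∩ cyl m s) := fun Y => by
    rw [hν₁, Measure.smul_apply, Measure.map_apply hX (Set.to_countable Y).measurableSet,
      Measure.restrict_apply (hX (Set.to_countable Y).measurableSet), smul_eq_mul]
  have e₂ : ∀ Y : Set 𝒳, ν₂ Y = μ (cyl m s) * μ ((fun ω => ω 1) ⁻¹' Y ∩ cyl K b) := fun Y => by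
    rw [hν₂, Measure.smul_apply, Measure.map_apply hX (Set.to_countable Y).measurableSet,
      Measure.restrict_apply (hX (Set.to_countable Y).measurableSet), smul_eq_mul]
  rw [← e₁, ← e₂]
  have hfin : IsFiniteMeasure ν₁ := ⟨by rw [e₁]; finiteness⟩
  have hle : ν₁ ≤ ν₂ := by
    refine measure_le_of_singleton fun y => ?_
    rw [e₁, e₂]
    change μ (cyl K b) * μ ({ω | ω 1 = y} ∩ cyl m s) ≤ μ (cyl m s) * μ ({ω | ω 1 = y} ∩ cyl K b)
    rcases eq_or_ne (μ ({ω | ω 1 = y} ∩ cyl m s)) 0 with h0 | h0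
    · rw [h0, mul_zero]; exact bot_le
    have hpos : 0 < (μ ({ω | ω 1 = y} ∩ cyl m s)).toReal :=
      ENNReal.toReal_pos h0 (measure_ne_top _ _)
    have hms : 0 < (μ (cyl m s)).toReal := hpos.trans_le
      (ENNReal.toReal_mono (measure_ne_top _ _) (measure_mono inter_subset_right))
    have hKb : 0 < (μ (cyl K b)).toReal := by
      rw [← cyl_congr hs]
      exact hms.trans_le (ENNReal.toReal_mono (measure_ne_top _ _)
        (measure_mono (cyl_anti hm.le s)))
    have hpre : prependOld b K (fun j => s (j + K)) = s := by
      rw [← prependOld_congr hs, prependOld_tail]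
    have hKm : K + (m - K) = m := by omega
    have key := hb (m - K) (by omega) y (fun j => s (j + K)) (by
      rw [hpre, hKm, pstr_withLast hT]; exact hpos)
    rw [hpre, hKm, pcond_eq, pcond_eq, div_eq_div_iff hKb.ne' hms.ne'] at key
    rw [← ENNReal.toReal_le_toReal (by finiteness) (by finiteness), ENNReal.toReal_mul,
      ENNReal.toReal_mul]
    linarith
  have huniv : ν₁ univ = ν₂ univ := by
    rw [e₁, e₂, preimage_univ, univ_inter, univ_inter, mul_comm]
  rw [Measure.eq_of_le_of_measure_univ_eq hle huniv]

/-- Given a string satisfying the memory condition, the next symbol is independent of the past. -/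
lemma indepFun_past_next (hT : MeasurePreserving shift μ μ) {b : ℕ → 𝒳} {K : ℕ}
    (hb : IsMemoryBound μ b K) :
    ProbabilityTheory.IndepFun past (fun ω : Path 𝒳 => ω 1)
      (ProbabilityTheory.cond μ (cyl K b)) := by
  have hX : Measurable fun ω : Path 𝒳 => ω 1 := measurable_pi_apply (1 : ℤ)
  have hB := measurableSet_cyl (𝒳 := 𝒳) K b
  rcases eq_or_ne (μ (cyl K b)) 0 with h0 | h0
  · rw [ProbabilityTheory.cond_eq_zero_of_meas_eq_zero h0]
    rw [ProbabilityTheory.indepFun_iff_measure_inter_preimage_eq_mul]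
    intro _ _ _ _
    simp
  have key : ∀ Y : Set 𝒳, ∀ D : Set (ℕ → 𝒳), MeasurableSet D →
      μ (cyl K b) * μ (cyl K b ∩ (past ⁻¹' D ∩ (fun ω => ω 1) ⁻¹' Y)) =
        μ (cyl K b ∩ past ⁻¹' D) * μ (cyl K b ∩ (fun ω => ω 1) ⁻¹' Y) := by
    intro Y D hD
    have hY := hX (Set.to_countable Y).measurableSet
    set ν₁ : Measure (ℕ → 𝒳) :=
      μ (cyl K b) • (μ.restrict (cyl K b ∩ (fun ω => ω 1) ⁻¹' Y)).map past with hν₁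
    set ν₂ : Measure (ℕ → 𝒳) :=
      μ (cyl K b ∩ (fun ω => ω 1) ⁻¹' Y) • (μ.restrict (cyl K b)).map past with hν₂
    have e₁ : ∀ D : Set (ℕ → 𝒳), MeasurableSet D → ν₁ D =
        μ (cyl K b) * μ (cyl K b ∩ (past ⁻¹' D ∩ (fun ω => ω 1) ⁻¹' Y)) := fun D hD => by
      rw [hν₁, Measure.smul_apply, Measure.map_apply measurable_past hD,
        Measure.restrict_apply (measurable_past hD), smul_eq_mul, inter_left_comm]
    have e₂ : ∀ D : Set (ℕ → 𝒳), MeasurableSet D → ν₂ D =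
        μ (cyl K b ∩ past ⁻¹' D) * μ (cyl K b ∩ (fun ω => ω 1) ⁻¹' Y) := fun D hD => by
      rw [hν₂, Measure.smul_apply, Measure.map_apply measurable_past hD,
        Measure.restrict_apply (measurable_past hD), smul_eq_mul, inter_comm (past ⁻¹' D),
        mul_comm]
    rw [← e₁ D hD, ← e₂ D hD]
    have hfin : IsFiniteMeasure ν₁ := ⟨by rw [e₁ _ .univ]; finiteness⟩
    congr 1
    refine measure_ext_pastCyl ?_ fun m s => ?_
    · rw [e₁ _ .univ, e₂ _ .univ, preimage_univ, univ_inter, inter_univ]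
    rw [e₁ _ (measurableSet_pastCyl m s), e₂ _ (measurableSet_pastCyl m s), past_preimage_pastCyl]
    by_cases hag : ∀ j < min m K, s j = b j
    · rcases lt_or_ge K m with hm | hm
      · have hs : ∀ j < K, s j = b j := fun j hj => hag j (by omega)
        have hsub : cyl (𝒳 := 𝒳) K b ∩ cyl m s = cyl m s := by
          rw [← cyl_congr hs]; exact inter_eq_right.2 (cyl_anti hm.le s)
        rw [← inter_assoc, hsub, inter_comm (cyl m s), inter_comm (cyl K b)]
        exact measure_next_inter_cyl_of_isMemoryBound hT hb hm hs Y
      · have hsub : cyl (𝒳 := 𝒳) K b ∩ cyl m s = cyl K b := by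
          rw [cyl_congr (s := s) (s' := b) fun j hj => hag j (by omega)]
          exact inter_eq_left.2 (cyl_anti hm b)
        rw [← inter_assoc, hsub]
    · have hsub : cyl (𝒳 := 𝒳) K b ∩ cyl m s = ∅ := by
        rw [Set.eq_empty_iff_forall_notMem]
        rintro ω ⟨h1, h2⟩
        exact hag fun j hj => by rw [← h1 j (by omega), ← h2 j (by omega)]
      rw [← inter_assoc, hsub]
      simp
  rw [ProbabilityTheory.indepFun_iff_measure_inter_preimage_eq_mul]
  intro D Y hD hY
  rw [ProbabilityTheory.cond_apply hB, ProbabilityTheory.cond_apply hB,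
    ProbabilityTheory.cond_apply hB]
  have := key Y D hD
  have hne : μ (cyl K b) ≠ ⊤ := measure_ne_top _ _
  calc (μ (cyl K b))⁻¹ * μ (cyl K b ∩ (past ⁻¹' D ∩ (fun ω => ω 1) ⁻¹' Y))
      = (μ (cyl K b))⁻¹ * (((μ (cyl K b))⁻¹ * μ (cyl K b)) *
          μ (cyl K b ∩ (past ⁻¹' D ∩ (fun ω => ω 1) ⁻¹' Y))) := by
        rw [ENNReal.inv_mul_cancel h0 hne, one_mul]
    _ = (μ (cyl K b))⁻¹ * (μ (cyl K b))⁻¹ *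
          (μ (cyl K b) * μ (cyl K b ∩ (past ⁻¹' D ∩ (fun ω => ω 1) ⁻¹' Y))) := by ring
    _ = _ := by rw [this]; ring

end Memory

lemma ae_condExp_eq_of_setIntegral_eq {Ω : Type*} {m m₀ : MeasurableSpace Ω} {μ : Measure Ω}
    [IsFiniteMeasure μ] (hm : m ≤ m₀) {φ : Ω → ℝ} (hφ : Integrable φ μ) {A : Set Ω}
    (hA : MeasurableSet[m] A) {c : ℝ}
    (h : ∀ C, MeasurableSet[m] C → ∫ ω in C ∩ A, φ ω ∂μ = c * μ.real (C ∩ A)) :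
    ∀ᵐ ω ∂μ, ω ∈ A → (μ[φ|m]) ω = c := by
  have h1 : A.indicator (fun _ => c) =ᵐ[μ] μ[A.indicator φ|m] := by
    refine ae_eq_condExp_of_forall_setIntegral_eq hm (hφ.indicator (hm _ hA))
      (fun C _ _ => ((integrable_const c).indicator (hm _ hA)).integrableOn) (fun C hC _ => ?_)
      ((stronglyMeasurable_const.indicator hA).aestronglyMeasurable)
    rw [setIntegral_indicator (hm _ hA), setIntegral_indicator (hm _ hA), h C hC,
      setIntegral_const, smul_eq_mul, mul_comm]
  filter_upwards [h1, condExp_indicator hφ hA] with ω h2 h3 hω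
  rw [h3, indicator_of_mem hω, indicator_of_mem hω] at h2
  exact h2.symm

section NextMean

variable {μ : Measure (Path 𝒳)}

/-- The conditional mean of `g (X_1)` given that the last `K` symbols are `b`. -/
def nextMean (μ : Measure (Path 𝒳)) (g : 𝒳 → ℝ) (K : ℕ) (b : ℕ → 𝒳) : ℝ :=
  ∫ ω, g (ω 1) ∂(ProbabilityTheory.cond μ (cyl K b))

lemma nextMean_congr {g : 𝒳 → ℝ} {K : ℕ} {b b' : ℕ → 𝒳} (h : ∀ j < K, b j = b' j) :
    nextMean μ g K b = nextMean μ g K b' := by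
  rw [nextMean, nextMean, cyl_congr h]

variable [Countable 𝒳] [MeasurableSingletonClass 𝒳] [IsProbabilityMeasure μ]

lemma integrable_of_bounded {Ω : Type*} [MeasurableSpace Ω] {ν : Measure Ω} [IsFiniteMeasure ν]
    {g : 𝒳 → ℝ} (hg : ∃ M, ∀ x, |g x| ≤ M) {X : Ω → 𝒳} (hX : Measurable X) :
    Integrable (fun ω => g (X ω)) ν := by
  obtain ⟨M, hM⟩ := hg
  exact Integrable.of_bound ((measurable_of_countable g).comp hX).aestronglyMeasurable M
    (ae_of_all _ fun ω => hM _)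

lemma setIntegral_next (hT : MeasurePreserving shift μ μ) {b : ℕ → 𝒳} {K : ℕ}
    (hb : IsMemoryBound μ b K) (g : 𝒳 → ℝ) {D : Set (ℕ → 𝒳)}
    (hD : MeasurableSet D) :
    ∫ ω in past ⁻¹' D ∩ cyl K b, g (ω 1) ∂μ =
      nextMean μ g K b * μ.real (past ⁻¹' D ∩ cyl K b) := by
  have hB := measurableSet_cyl (𝒳 := 𝒳) K b
  rcases eq_or_ne (μ (cyl K b)) 0 with h0 | h0
  · have : μ (past ⁻¹' D ∩ cyl K b) = 0 := measure_mono_null inter_subset_right h0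
    rw [Measure.restrict_eq_zero.2 this, integral_zero_measure, measureReal_def, this]
    simp
  have hX : Measurable fun ω : Path 𝒳 => ω 1 := measurable_pi_apply (1 : ℤ)
  have : IsProbabilityMeasure (ProbabilityTheory.cond μ (cyl K b)) :=
    ProbabilityTheory.cond_isProbabilityMeasure h0
  have hφ : Measurable (D.indicator fun _ => (1 : ℝ)) := measurable_const.indicator hD
  have hI := (indepFun_past_next hT hb).comp hφ (measurable_of_countable g)
  have h1 := hI.integral_fun_mul_eq_mul_integral
    (hφ.comp measurable_past).aestronglyMeasurable
    ((measurable_of_countable g).comp hX).aestronglyMeasurable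
  have e1 : (fun ω => ((D.indicator fun _ => (1 : ℝ)) ∘ past) ω * (g ∘ fun ω : Path 𝒳 => ω 1) ω) =
      (past ⁻¹' D).indicator fun ω => g (ω 1) := by
    funext ω
    by_cases h : past ω ∈ D <;> simp [h, indicator]
  have e2 : ((D.indicator fun _ => (1 : ℝ)) ∘ past) =
      (past ⁻¹' D).indicator fun _ : Path 𝒳 => (1 : ℝ) := rfl
  rw [e1, e2, integral_indicator (measurable_past hD), integral_indicator (measurable_past hD),
    setIntegral_const, smul_eq_mul, mul_one] at h1
  have e3 : (ProbabilityTheory.cond μ (cyl K b)).restrict (past ⁻¹' D) =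
      (μ (cyl K b))⁻¹ • μ.restrict (past ⁻¹' D ∩ cyl K b) := by
    rw [ProbabilityTheory.cond, Measure.restrict_smul, Measure.restrict_restrict
      (measurable_past hD)]
  rw [e3, integral_smul_measure, measureReal_def, ProbabilityTheory.cond_apply hB,
    ENNReal.toReal_mul, ENNReal.toReal_inv, inter_comm (cyl K b), smul_eq_mul, mul_assoc] at h1
  have hne : (μ (cyl K b)).toReal⁻¹ ≠ 0 :=
    inv_ne_zero (ENNReal.toReal_pos h0 (measure_ne_top _ _)).ne'
  rw [mul_left_cancel₀ hne h1, mul_comm]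
  rfl

/-- The predictor agrees with `nextMean` on pasts satisfying the memory condition. -/
lemma ae_predictor_eq (hT : MeasurePreserving shift μ μ) {g : 𝒳 → ℝ} (hg : ∃ M, ∀ x, |g x| ≤ M)
    {F : (ℕ → 𝒳) → ℝ} (hF : IsPredictor μ g F) :
    ∀ᵐ ω ∂μ, ∀ K : ℕ, IsMemoryBound μ (past ω) K → F (past ω) = nextMean μ g K (past ω) := by
  have hX : Measurable fun ω : Path 𝒳 => ω 1 := measurable_pi_apply (1 : ℤ)
  have hall : ∀ᵐ ω ∂μ, ∀ K : ℕ, ∀ b : ℕ → 𝒳, IsMemoryBound μ b K → ω ∈ cyl K b →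
      (μ[fun ω => g (ω 1)|pastSigma 𝒳]) ω = nextMean μ g K b := by
    rw [ae_all_iff]
    intro K
    refine ae_forall_string K (fun ω s s' hs h hb hω => ?_) fun b => ?_
    · rw [← nextMean_congr hs]
      refine h (isMemoryBound_congr (fun j hj => (hs j hj).symm) hb) ?_
      rwa [cyl_congr hs]
    · by_cases hb : IsMemoryBound μ b K
      · have := ae_condExp_eq_of_setIntegral_eq (μ := μ) (m := pastSigma 𝒳)
          measurable_past.comap_le (integrable_of_bounded hg hX) (A := cyl K b)
          (c := nextMean μ g K b) ⟨pastCyl K b, measurableSet_pastCyl K b, rfl⟩ ?_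
        · filter_upwards [this] with ω hω _ using hω
        · rintro _ ⟨D, hD, rfl⟩
          exact setIntegral_next hT hb g hD
      · exact ae_of_all _ fun ω h => absurd h hb
  filter_upwards [hall, hF] with ω h1 h2 K hK
  rw [h2]
  exact h1 K _ hK fun j _ => rfl

end NextMean

section LambdaCondExp

variable {μ : Measure (Path 𝒳)} {l : ℕ → ℕ} {β γ : ℝ}
  [Countable 𝒳] [MeasurableSingletonClass 𝒳]

lemma fullPastSigma_le (j : ℕ) : fullPastSigma (𝒳 := 𝒳) β γ l j ≤ MeasurableSpace.pi := by
  refine Measurable.comap_le ((measurable_lambda β γ l j).prodMk (measurable_pi_lambda _ fun i =>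
    measurable_apply_int measurable_id ((measurable_lambda β γ l j).sub_const _)))

lemma segSigma_le (j : ℕ) : segSigma (𝒳 := 𝒳) β γ l j ≤ fullPastSigma β γ l j := by
  have : segObs (𝒳 := 𝒳) β γ l j =
      (fun p : ℤ × (ℕ → 𝒳) => (p.1, fun i => p.2 (min i p.1.toNat))) ∘ fullPastObs β γ l j := by
    funext ω
    refine Prod.ext rfl (funext fun i => ?_)
    have h0 := lambda_nonneg (β := β) (γ := γ) (l := l) (ω := ω) j
    simp only [segObs, fullPastObs, Function.comp_apply]
    congr 1
    omega
  rw [segSigma, fullPastSigma, this, ← MeasurableSpace.comap_comp]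
  refine MeasurableSpace.comap_mono (Measurable.comap_le (measurable_fst.prodMk
    (measurable_pi_lambda _ fun i => ?_)))
  exact measurable_apply_countable (N := fun p : ℤ × (ℕ → 𝒳) => min i p.1.toNat)
    (h := fun n p => p.2 n) ((measurable_of_countable fun z : ℤ => min i z.toNat).comp measurable_fst)
    fun n => (measurable_pi_apply n).comp measurable_snd

lemma measurableSet_of_determined {m : ℕ} {S : Set (ℕ → 𝒳)}
    (h : ∀ x y : ℕ → 𝒳, (∀ j < m, x j = y j) → x ∈ S → y ∈ S) : MeasurableSet S := by
  have := measurable_of_factors (φ := fun (x : ℕ → 𝒳) (i : Fin m) => x i) (g := fun x => x ∈ S)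
    (measurable_pi_lambda _ fun i => measurable_pi_apply _) fun x y hxy =>
      propext ⟨h x y fun j hj => congrFun hxy ⟨j, hj⟩, h y x fun j hj => (congrFun hxy ⟨j, hj⟩).symm⟩
  convert! this (MeasurableSet.of_discrete (s := {True})) using 1
  ext x
  simp

variable [IsProbabilityMeasure μ]

/-- Up to a null set, `{λ_j = t}` is determined by the symbols at times `0, …, t`. -/
lemma exists_lambda_eq_ae (hT : MeasurePreserving shift μ μ) (hl : Monotone l)
    (hl' : Tendsto l atTop atTop) (hll : ∀ k, 1 ≤ k → l k ≤ k) (j t : ℕ) :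
    ∃ S : Set (ℕ → 𝒳), MeasurableSet S ∧
      ∀ᵐ ω ∂μ, lambda β γ l ω j = t ↔ past (tshift t ω) ∈ S := by
  refine ⟨{x | ∃ ω, IsGood l ω ∧ lambda β γ l ω j = t ∧ ∀ i < t + 1, x i = past (tshift t ω) i},
    measurableSet_of_determined (m := t + 1) ?_, ?_⟩
  · rintro x y hxy ⟨ω, h1, h2, h3⟩
    exact ⟨ω, h1, h2, fun i hi => by rw [← hxy i hi, h3 i hi]⟩
  · filter_upwards [ae_isGood hT l] with ω hω
    refine ⟨fun h => ⟨ω, hω, h, fun _ _ => rfl⟩, ?_⟩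
    rintro ⟨ω', h1, h2, h3⟩
    rw [← h2]
    refine h1.lambda_causal hll hl hl' hω (t := t) (fun i h0 hi => ?_) h2.le
    have := h3 (t - i).toNat (by omega)
    simp only [past, tshift] at this
    rw [show -((t - i).toNat : ℤ) + t = i by omega] at this
    exact this.symm

lemma setIntegral_next_shift (hT : MeasurePreserving shift μ μ) {b : ℕ → 𝒳} {K : ℕ}
    (hb : IsMemoryBound μ b K) (g : 𝒳 → ℝ) {D : Set (ℕ → 𝒳)} (hD : MeasurableSet D) (t : ℕ) :
    ∫ ω in tshift t ⁻¹' (past ⁻¹' D ∩ cyl K b), g (ω (t + 1)) ∂μ =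
      nextMean μ g K b * μ.real (tshift t ⁻¹' (past ⁻¹' D ∩ cyl K b)) := by
  have hTt := measurePreserving_tshift hT t
  have hS : MeasurableSet (past ⁻¹' D ∩ cyl (𝒳 := 𝒳) K b) :=
    (measurable_past hD).inter (measurableSet_cyl K b)
  have hg : Measurable fun ω : Path 𝒳 => g (ω 1) :=
    (measurable_of_countable g).comp (measurable_pi_apply (1 : ℤ))
  rw [measureReal_def, hTt.measure_preimage hS.nullMeasurableSet, ← measureReal_def,
    ← setIntegral_next hT hb g hD]
  conv_rhs => rw [← hTt.map_eq]
  rw [setIntegral_map hS hg.aestronglyMeasurable (measurable_tshift _).aemeasurable]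
  refine setIntegral_congr_fun (measurable_tshift _ hS) fun ω _ => ?_
  simp only [tshift, add_comm]

/-- The event that `λ_j = t` and that the last `K` symbols at time `t` are given by `b`. -/
def lambdaCyl (β γ : ℝ) (l : ℕ → ℕ) (j t K : ℕ) (b : ℕ → 𝒳) : Set (Path 𝒳) :=
  {ω | lambda β γ l ω j = t ∧ ∀ r < K, ω (t - (r : ℤ)) = b r}

lemma measurableSet_lambdaCyl (j : ℕ) {t K : ℕ} (hK : K ≤ t) (b : ℕ → 𝒳) :
    MeasurableSet[segSigma β γ l j] (lambdaCyl β γ l j t K b) := by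
  refine ⟨_, (measurableSet_singleton (t : ℤ)).prod (measurableSet_pastCyl K b), ?_⟩
  ext ω
  simp only [lambdaCyl, mem_ofPred_eq, mem_preimage, mem_prod, mem_singleton_iff, segObs,
    mem_pastCyl]
  refine and_congr_right fun h => forall₂_congr fun r hr => ?_
  rw [h, max_eq_left (by omega)]

lemma setIntegral_lambda_next (hT : MeasurePreserving shift μ μ) (hl : Monotone l)
    (hl' : Tendsto l atTop atTop) (hll : ∀ k, 1 ≤ k → l k ≤ k) (g : 𝒳 → ℝ) {j t K : ℕ}
    {b : ℕ → 𝒳} (hb : IsMemoryBound μ b K) (hK : K ≤ t) {C : Set (Path 𝒳)}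
    (hC : MeasurableSet[fullPastSigma β γ l j] C) :
    ∫ ω in C ∩ lambdaCyl β γ l j t K b, g (ω (lambda β γ l ω j + 1)) ∂μ =
      nextMean μ g K b * μ.real (C ∩ lambdaCyl β γ l j t K b) := by
  have hm0 : MeasurableSet (C ∩ lambdaCyl β γ l j t K b) :=
    (fullPastSigma_le j _ hC).inter (((segSigma_le j).trans (fullPastSigma_le j)) _
      (measurableSet_lambdaCyl j hK b))
  obtain ⟨E, hE, rfl⟩ := hC
  obtain ⟨S, hS, hS'⟩ := exists_lambda_eq_ae (β := β) (γ := γ) hT hl hl' hll j t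
  set D : Set (ℕ → 𝒳) := S ∩ (fun x => ((t : ℤ), x)) ⁻¹' E with hDdef
  have hD : MeasurableSet D := hS.inter (measurable_prodMk_left hE)
  have hae : (fullPastObs β γ l j ⁻¹' E ∩ lambdaCyl β γ l j t K b : Set (Path 𝒳)) =ᵐ[μ]
      (tshift t ⁻¹' (past ⁻¹' D ∩ cyl K b) : Set (Path 𝒳)) := by
    refine eventuallyEq_set.2 ?_
    filter_upwards [hS'] with ω hω
    have hp : past (tshift t ω) = fun r : ℕ => ω (t - (r : ℤ)) := funext fun r => by
      simp only [past, tshift]; congr 1; ring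
    rw [← past_preimage_pastCyl]
    simp only [lambdaCyl, hDdef, mem_inter_iff, mem_preimage, mem_ofPred_eq, fullPastObs, ← hω,
      mem_pastCyl]
    rw [hp]
    constructor
    · rintro ⟨h1, h2, h3⟩
      rw [h2] at h1
      exact ⟨⟨h2, h1⟩, h3⟩
    · rintro ⟨⟨h2, h1⟩, h3⟩
      rw [h2]
      exact ⟨h1, rfl, h3⟩
  have hφ : ∀ᵐ ω ∂μ, ω ∈ (fullPastObs β γ l j ⁻¹' E ∩ lambdaCyl β γ l j t K b : Set (Path 𝒳)) →
      g (ω (lambda β γ l ω j + 1)) = g (ω (t + 1)) := ae_of_all _ fun ω hω => by rw [hω.2.1]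
  rw [setIntegral_congr_ae hm0 hφ, setIntegral_congr_set hae, measureReal_congr hae]
  exact setIntegral_next_shift hT hb g hD t

lemma integrable_lambda_next {g : 𝒳 → ℝ} (hg : ∃ M, ∀ x, |g x| ≤ M) (j : ℕ) :
    Integrable (fun ω => g (ω (lambda β γ l ω j + 1))) μ :=
  integrable_of_bounded hg
    (measurable_apply_int measurable_id ((measurable_lambda β γ l j).add_const _))

lemma ae_condExp_lambda_eq (hT : MeasurePreserving shift μ μ) (hl : Monotone l)
    (hl' : Tendsto l atTop atTop) (hll : ∀ k, 1 ≤ k → l k ≤ k) {g : 𝒳 → ℝ}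
    (hg : ∃ M, ∀ x, |g x| ≤ M) {j : ℕ} {m : MeasurableSpace (Path 𝒳)}
    (hm : segSigma β γ l j ≤ m) (hm' : m ≤ fullPastSigma β γ l j) :
    ∀ᵐ ω ∂μ, ∀ t K : ℕ, ∀ b : ℕ → 𝒳, IsMemoryBound μ b K → K ≤ t → lambda β γ l ω j = t →
      (∀ r < K, ω (t - (r : ℤ)) = b r) →
      (μ[fun ω' => g (ω' (lambda β γ l ω' j + 1))|m]) ω = nextMean μ g K b := by
  rw [ae_all_iff]
  intro t
  rw [ae_all_iff]
  intro K
  refine ae_forall_string K (fun ω s s' hs h hb hK ht hω => ?_) fun b => ?_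
  · rw [← nextMean_congr hs]
    exact h (isMemoryBound_congr (fun j hj => (hs j hj).symm) hb) hK ht fun r hr => by
      rw [hω r hr, hs r hr]
  by_cases hb : IsMemoryBound μ b K
  swap
  · exact ae_of_all _ fun ω h => absurd h hb
  by_cases hK : K ≤ t
  swap
  · exact ae_of_all _ fun ω _ h => absurd h hK
  have := ae_condExp_eq_of_setIntegral_eq (μ := μ) (m := m) (hm'.trans (fullPastSigma_le j))
    (integrable_lambda_next hg j) (hm _ (measurableSet_lambdaCyl j hK b))
    fun C hC => setIntegral_lambda_next hT hl hl' hll g hb hK (hm' _ hC)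
  filter_upwards [this] with ω hω _ _ h1 h2 using hω ⟨h1, h2⟩

end LambdaCondExp

section LowerBound

variable {μ : Measure (Path 𝒳)}

open Classical in
lemma cnt_add_one (ω : Path 𝒳) (m : ℕ) (s : ℕ → 𝒳) {a b : ℤ} (h : a ≤ b + 1) :
    cnt ω m s a (b + 1) = cnt ω m s a b + if OccursAt ω m s (b + 1) then 1 else 0 := by
  have e : Finset.Icc a (b + 1) = insert (b + 1) (Finset.Icc a b) := by
    ext t
    simp only [Finset.mem_Icc, Finset.mem_insert]
    omega
  unfold cnt
  rw [e, Finset.filter_insert]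
  split_ifs with h1
  · rw [Finset.card_insert_of_notMem (by simp)]
  · rfl

lemma cnt_eq_zero (ω : Path 𝒳) (m : ℕ) (s : ℕ → 𝒳) {a b : ℤ} (h : b < a) :
    cnt ω m s a b = 0 := by
  simp [cnt, Finset.Icc_eq_empty_of_lt h]

lemma occursAt_withLast_iff {ω : Path 𝒳} {m : ℕ} {c : ℕ → 𝒳} {x : 𝒳} {t : ℤ} :
    OccursAt ω (m + 1) (withLast x c) (t + 1) ↔ ω (t + 1) = x ∧ OccursAt ω m c t := by
  constructor
  · intro h
    refine ⟨by simpa [withLast] using h 0 (by omega), fun j hj => ?_⟩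
    have := h (j + 1) (by omega)
    simp only [withLast, Nat.add_eq_zero_iff, one_ne_zero, and_false, if_false,
      Nat.add_sub_cancel] at this
    rw [← this]
    congr 1
    push_cast; ring
  · rintro ⟨h0, h⟩ j hj
    rcases j with _ | j
    · simpa [withLast] using h0
    · simp only [withLast, Nat.add_eq_zero_iff, one_ne_zero, and_false, if_false,
        Nat.add_sub_cancel]
      rw [← h j (by omega)]
      congr 1
      push_cast; ring

lemma cnt_le_cnt {ω : Path 𝒳} {m m' : ℕ} {s s' : ℕ → 𝒳} {a b a' b' : ℤ} (d : ℤ)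
    (h : ∀ t, a ≤ t → t ≤ b → OccursAt ω m s t → a' ≤ t + d ∧ t + d ≤ b' ∧
      OccursAt ω m' s' (t + d)) : cnt ω m s a b ≤ cnt ω m' s' a' b' := by
  refine Finset.card_le_card_of_injOn (· + d) (fun t ht => ?_) fun t _ t' _ h => by simpa using h
  simp only [Finset.coe_filter, Finset.mem_Icc, mem_ofPred_eq] at ht ⊢
  obtain ⟨h1, h2, h3⟩ := h t ht.1.1 ht.1.2 ht.2
  exact ⟨⟨h1, h2⟩, h3⟩

lemma cnt_withLast_le {ω : Path 𝒳} {m : ℕ} {s : ℕ → 𝒳} (x : 𝒳) (a b : ℤ) :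
    cnt ω (m + 1) (withLast x s) a b ≤ cnt ω m s (a - 1) (b - 1) := by
  refine cnt_le_cnt (-1) fun t h1 h2 h => ⟨by omega, by omega, ?_⟩
  rw [← sub_add_cancel t 1] at h
  exact (occursAt_withLast_iff.1 h).2

lemma cnt_add_cnt {ω : Path 𝒳} {m : ℕ} {s : ℕ → 𝒳} {a b c : ℤ} (hab : a ≤ b) (hbc : b ≤ c) :
    cnt ω m s a (c - 1) = cnt ω m s a (b - 1) + cnt ω m s b (c - 1) := by
  classical
  have e : Finset.Icc a (c - 1) = Finset.Icc a (b - 1) ∪ Finset.Icc b (c - 1) := by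
    ext t
    simp only [Finset.mem_union, Finset.mem_Icc]
    omega
  unfold cnt
  rw [e, Finset.filter_union, Finset.card_union_of_disjoint]
  refine Finset.disjoint_filter_filter (Finset.disjoint_left.2 fun t h1 h2 => ?_)
  rw [Finset.mem_Icc] at h1 h2
  omega

lemma tendsto_div_of_abs_sub_le {a : ℕ → ℕ} {r C : ℝ}
    (ha : ∀ᶠ n : ℕ in atTop, |(a n : ℝ) - r * n| ≤ C) :
    Tendsto (fun n : ℕ => (a n : ℝ) / n) atTop (𝓝 r) := by
  rw [← tendsto_sub_nhds_zero_iff]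
  refine squeeze_zero_norm' ?_ (tendsto_const_div_atTop_nhds_zero_nat C)
  filter_upwards [ha, eventually_ge_atTop 1] with n hn h1
  have : (0 : ℝ) < n := by exact_mod_cast h1
  rw [Real.norm_eq_abs, show (a n : ℝ) / n - r = ((a n : ℝ) - r * n) / n by field_simp, abs_div,
    abs_of_pos this]
  gcongr

lemma tendsto_atTop_of_abs_sub_le {a : ℕ → ℕ} {r C : ℝ} (hr : 0 < r)
    (ha : ∀ᶠ n : ℕ in atTop, |(a n : ℝ) - r * n| ≤ C) : Tendsto a atTop atTop := by
  rw [← tendsto_natCast_atTop_iff (R := ℝ)]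
  refine tendsto_atTop_mono' atTop (f₁ := fun n : ℕ => r * n + -C) ?_
    (tendsto_atTop_add_const_right _ _ (tendsto_natCast_atTop_atTop.const_mul_atTop hr))
  filter_upwards [ha] with n hn
  linarith [(abs_le.1 hn).1]

lemma tendsto_cnt_div {ω : Path 𝒳} {m : ℕ} {s : ℕ → 𝒳} {p : ℝ}
    (h : Tendsto (fun n : ℕ => (cnt ω m s 0 ((n : ℤ) - 1) : ℝ) / n) atTop (𝓝 p)) {a b : ℕ → ℕ}
    {ra rb Ca Cb : ℝ} (hra : 0 < ra) (hrb : 0 < rb)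
    (ha : ∀ᶠ n : ℕ in atTop, |(a n : ℝ) - ra * n| ≤ Ca)
    (hb : ∀ᶠ n : ℕ in atTop, |(b n : ℝ) - rb * n| ≤ Cb) (hab : ∀ᶠ n in atTop, a n ≤ b n) :
    Tendsto (fun n : ℕ => (cnt ω m s (a n) ((b n : ℤ) - 1) : ℝ) / n) atTop
      (𝓝 ((rb - ra) * p)) := by
  have key : ∀ {a : ℕ → ℕ} {r C : ℝ}, 0 < r → (∀ᶠ n : ℕ in atTop, |(a n : ℝ) - r * n| ≤ C) →
      Tendsto (fun n : ℕ => (cnt ω m s 0 ((a n : ℤ) - 1) : ℝ) / n) atTop (𝓝 (r * p)) := by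
    intro a r C hr ha
    have htop := tendsto_atTop_of_abs_sub_le hr ha
    refine ((tendsto_div_of_abs_sub_le ha).mul (h.comp htop)).congr' ?_
    filter_upwards [htop.eventually_ge_atTop 1] with n hn
    have : (a n : ℝ) ≠ 0 := by positivity
    simp only [Function.comp_apply]
    rw [div_mul_div_comm, mul_comm (a n : ℝ), mul_div_mul_right _ _ this]
  rw [sub_mul]
  refine ((key hrb hb).sub (key hra ha)).congr' ?_
  filter_upwards [hab] with n hn
  rw [cnt_add_cnt (a := 0) (b := (a n : ℤ)) (c := (b n : ℤ)) (by omega) (by omega), ← sub_div]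
  push_cast
  rw [add_sub_cancel_left]

variable [IsProbabilityMeasure μ] [Countable 𝒳] [MeasurableSingletonClass 𝒳]

lemma ae_tendsto_cnt (hT : Ergodic (shift : Path 𝒳 → Path 𝒳) μ) :
    ∀ᵐ ω ∂μ, ∀ (m : ℕ) (s : ℕ → 𝒳),
      Tendsto (fun n : ℕ => (cnt ω m s 0 ((n : ℤ) - 1) : ℝ) / n) atTop (𝓝 (pstr μ m s)) := by
  refine ae_all_iff.2 fun m => ae_forall_string m (fun ω s s' h hs => ?_) fun s => ?_
  · rw [pstr_eq, ← cyl_congr h, ← pstr_eq]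
    refine hs.congr fun n => ?_
    rw [cnt_congr fun t _ _ => occursAt_congr h fun _ _ => rfl]
  · have hg : Measurable ((cyl m s).indicator fun _ : Path 𝒳 => (1 : ℝ)) :=
      measurable_const.indicator (measurableSet_cyl m s)
    have hM : ∀ ω : Path 𝒳, |(cyl m s).indicator (fun _ => (1 : ℝ)) ω| ≤ 1 := fun ω => by
      by_cases h : ω ∈ cyl m s <;> simp [h]
    filter_upwards [ae_tendsto_birkhoffSum_div hT hg hM] with ω hω
    rw [integral_indicator_const _ (measurableSet_cyl m s), smul_eq_mul, mul_one] at hω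
    refine hω.congr fun n => ?_
    congr 1
    induction n with
    | zero => simp [cnt_eq_zero]
    | succ n ih =>
      rw [birkhoffSum_succ, ih, shift_iterate, show ((n + 1 : ℕ) : ℤ) - 1 = (n : ℤ) - 1 + 1 by
        push_cast; ring, cnt_add_one _ _ _ (by omega), sub_add_cancel]
      have hiff : tshift (n : ℤ) ω ∈ cyl m s ↔ OccursAt ω m s n := by
        refine forall₂_congr fun j _ => ?_
        rw [tshift, neg_add_eq_sub]
      by_cases h : OccursAt ω m s n
      · rw [if_pos h, indicator_of_mem (hiff.2 h)]
        push_cast; rfl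
      · rw [if_neg h, indicator_of_notMem fun h' => h (hiff.1 h')]
        simp

lemma empCond_mem_Icc (ω : Path 𝒳) (n m : ℕ) (x : 𝒳) (s : ℕ → 𝒳) :
    0 ≤ empCond ω n m x s ∧ empCond ω n m x s ≤ 1 := by
  refine ⟨by unfold empCond; positivity, div_le_one_of_le₀ ?_ (by positivity)⟩
  exact Nat.cast_le.2 (cnt_withLast_le _ _ _)

lemma half_bounds (n : ℕ) : (n : ℝ) / 2 ≤ half n ∧ (half n : ℝ) ≤ n / 2 + 1 / 2 := by
  have h1 : n ≤ 2 * half n := by unfold half; omega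
  have h2 : 2 * half n ≤ n + 1 := by unfold half; omega
  have h1' : (n : ℝ) ≤ 2 * half n := by exact_mod_cast h1
  have h2' : 2 * (half n : ℝ) ≤ n + 1 := by exact_mod_cast h2
  constructor <;> linarith

lemma abs_half_add_sub_le (m n : ℕ) :
    |((half n + m : ℕ) : ℝ) - 1 / 2 * n| ≤ m + 1 := by
  have := half_bounds n
  rw [abs_le]
  push_cast
  have hm : (0 : ℝ) ≤ m := by positivity
  constructor <;> linarith [this.1, this.2]

lemma abs_half_add_sub_one_sub_le (m : ℕ) {n : ℕ} (hn : 1 ≤ n) :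
    |((half n + m - 1 : ℕ) : ℝ) - 1 / 2 * n| ≤ m + 1 := by
  have := half_bounds n
  have h1 : 1 ≤ half n := by unfold half; omega
  rw [Nat.cast_sub (by omega), abs_le]
  push_cast
  have hm : (0 : ℝ) ≤ m := by positivity
  constructor <;> linarith [this.1, this.2]

lemma eventually_half_add_le (m : ℕ) : ∀ᶠ n : ℕ in atTop, half n + m ≤ n := by
  filter_upwards [eventually_ge_atTop (2 * m + 1)] with n hn
  unfold half
  omega

lemma tendsto_cnt_half {ω : Path 𝒳} {m : ℕ} {s : ℕ → 𝒳} {p : ℝ} (k : ℕ)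
    (h : Tendsto (fun n : ℕ => (cnt ω m s 0 ((n : ℤ) - 1) : ℝ) / n) atTop (𝓝 p)) :
    Tendsto (fun n : ℕ => (cnt ω m s ((half n : ℤ) + k) n : ℝ) / n) atTop (𝓝 (p / 2)) := by
  have := tendsto_cnt_div h (a := fun n => half n + k) (b := fun n => n + 1) (ra := 1 / 2)
    (rb := 1) (Cb := 1) (by norm_num) one_pos
    (Eventually.of_forall fun n => abs_half_add_sub_le k n)
    (Eventually.of_forall fun n => by simp)
    ((eventually_half_add_le k).mono fun n hn => by omega)
  rw [show ((1 : ℝ) - 1 / 2) * p = p / 2 by ring] at this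
  refine this.congr fun n => ?_
  push_cast
  rw [add_sub_cancel_right]

lemma tendsto_cnt_half_sub_one {ω : Path 𝒳} {m : ℕ} {s : ℕ → 𝒳} {p : ℝ} (k : ℕ)
    (h : Tendsto (fun n : ℕ => (cnt ω m s 0 ((n : ℤ) - 1) : ℝ) / n) atTop (𝓝 p)) :
    Tendsto (fun n : ℕ => (cnt ω m s ((half n : ℤ) + k - 1) ((n : ℤ) - 1) : ℝ) / n) atTop
      (𝓝 (p / 2)) := by
  have := tendsto_cnt_div h (a := fun n => half n + k - 1) (b := fun n => n) (ra := 1 / 2)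
    (rb := 1) (Cb := 0) (by norm_num) one_pos
    ((eventually_ge_atTop 1).mono fun n hn => abs_half_add_sub_one_sub_le k hn)
    (Eventually.of_forall fun n => by simp)
    ((eventually_half_add_le k).mono fun n hn => by omega)
  rw [show ((1 : ℝ) - 1 / 2) * p = p / 2 by ring] at this
  refine this.congr' ?_
  filter_upwards [eventually_ge_atTop 1] with n hn
  have h1 : 1 ≤ half n := by unfold half; omega
  rw [Nat.cast_sub (by omega)]
  push_cast
  rfl

lemma pstr_withLast_le (hT : MeasurePreserving shift μ μ) (m : ℕ) (y : 𝒳) (s : ℕ → 𝒳) :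
    pstr μ (m + 1) (withLast y s) ≤ pstr μ m s := by
  rw [pstr_withLast hT]
  exact ENNReal.toReal_mono (measure_ne_top _ _) (measure_mono inter_subset_right)

lemma tendsto_empCond (hT : MeasurePreserving shift μ μ) {ω : Path 𝒳}
    (h : ∀ (m : ℕ) (s : ℕ → 𝒳),
      Tendsto (fun n : ℕ => (cnt ω m s 0 ((n : ℤ) - 1) : ℝ) / n) atTop (𝓝 (pstr μ m s)))
    {m : ℕ} {x : 𝒳} {s : ℕ → 𝒳} (hs : 0 < pstr μ m s) :
    Tendsto (fun n => empCond ω n m x s) atTop (𝓝 (pcond μ m x s)) := by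
  have h1 := (tendsto_cnt_half m (h (m + 1) (withLast x s))).div
    (tendsto_cnt_half_sub_one m (h m s)) (by positivity)
  rw [div_div_div_cancel_right₀ two_ne_zero, pstr_withLast hT] at h1
  refine h1.congr' ?_
  filter_upwards [eventually_ge_atTop 1] with n hn
  have : (n : ℝ) ≠ 0 := by positivity
  exact div_div_div_cancel_right₀ this _ _

lemma eventually_lt_hatDelta (hT : MeasurePreserving shift μ μ) {β γ : ℝ} (hβ : 0 < β)
    (hγ : 0 < γ) {l : ℕ → ℕ} {ω : Path 𝒳}
    (h : ∀ (m : ℕ) (s : ℕ → 𝒳),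
      Tendsto (fun n : ℕ => (cnt ω m s 0 ((n : ℤ) - 1) : ℝ) / n) atTop (𝓝 (pstr μ m s)))
    {k : ℕ} (hk : ¬ IsMemoryBound μ (tildePast l ω) k) :
    ∀ᶠ n : ℕ in atTop, (n : ℝ) ^ (-β) < hatDelta γ l ω n k := by
  unfold IsMemoryBound at hk
  push Not at hk
  obtain ⟨i, hi, y, z, hpos, hne⟩ := hk
  set b := tildePast l ω
  set s := prependOld b k z with hs
  have hsb : ∀ j < k, s j = b j := fun j hj => by simp [hs, prependOld, hj]
  have hcnt := tendsto_cnt_half (k + i) (h (k + i + 1) (withLast y s))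
  have hL1 : ∀ᶠ n in atTop, inL1 ω n (k + i) (withLast y s) := by
    obtain ⟨n, hn⟩ := (hcnt.eventually_const_lt (half_pos hpos)).exists
    have hc : cnt ω (k + i + 1) (withLast y s) ((half n : ℤ) + (k + i : ℕ)) n ≠ 0 := fun h0 => by
      rw [h0, Nat.cast_zero, zero_div] at hn
      exact hn.false
    obtain ⟨t, ht⟩ := Finset.card_ne_zero.1 hc
    classical
    rw [Finset.mem_filter, Finset.mem_Icc] at ht
    filter_upwards [eventually_ge_atTop (2 * (t.toNat + 1))] with N hN
    refine ⟨t, by omega, ?_, ht.2⟩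
    unfold half
    omega
  have hL2 : ∀ᶠ n in atTop, inL2 γ ω n (k + i) (withLast y s) := by
    have h0 : Tendsto (fun n : ℕ => (n : ℝ) ^ (-γ)) atTop (𝓝 0) :=
      (tendsto_rpow_neg_atTop hγ).comp tendsto_natCast_atTop_atTop
    filter_upwards [h0.eventually_lt hcnt (half_pos hpos), eventually_ge_atTop 1] with n hn h1
    have hn0 : (0 : ℝ) < n := by exact_mod_cast h1
    rw [lt_div_iff₀ hn0] at hn
    unfold inL2
    rwa [show 1 - γ = -γ + 1 by ring, Real.rpow_add hn0, Real.rpow_one]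
  have hps : 0 < pstr μ (k + i) s := hpos.trans_le (pstr_withLast_le hT _ _ _)
  have hpb : 0 < pstr μ k b := by
    rw [pstr_eq, ← cyl_congr hsb]
    exact hps.trans_le (ENNReal.toReal_mono (measure_ne_top _ _)
      (measure_mono (cyl_anti (by omega) s)))
  have hd := ((tendsto_empCond hT h (x := y) hpb).sub (tendsto_empCond hT h (x := y) hps)).abs
  have h0 : Tendsto (fun n : ℕ => (n : ℝ) ^ (-β)) atTop (𝓝 0) :=
    (tendsto_rpow_neg_atTop hβ).comp tendsto_natCast_atTop_atTop
  filter_upwards [hL1, hL2, h0.eventually_lt hd (abs_pos.2 (sub_ne_zero.2 hne)),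
    eventually_ge_atTop i, eventually_ge_atTop (2 * ((zeta l ω (Jfun l k)).toNat + 1))]
    with n h1 h2 h3 h4 h5
  have hz : zeta l ω (Jfun l k) ≤ (half n : ℤ) - 1 := by
    unfold half
    omega
  unfold hatDelta
  rw [if_pos hz, one_mul]
  refine h3.trans_le (le_csSup ⟨1, ?_⟩ ⟨i, hi, h4, z, y, ⟨h1, h2⟩, rfl⟩)
  rintro d ⟨i, -, -, z, x, -, rfl⟩
  have e1 := empCond_mem_Icc ω n k x (tildePast l ω)
  have e2 := empCond_mem_Icc ω n (k + i) x (prependOld (tildePast l ω) k z)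
  rw [abs_le]
  constructor <;> linarith [e1.1, e1.2, e2.1, e2.2]

end LowerBound

section Consistency

variable {μ : Measure (Path 𝒳)} [IsProbabilityMeasure μ] [Countable 𝒳]
  [MeasurableSingletonClass 𝒳] {β γ : ℝ} {l : ℕ → ℕ} {ω : Path 𝒳}

lemma eventually_le_chi (hT : MeasurePreserving shift μ μ) (hβ : 0 < β) (hγ : 0 < γ)
    (h : ∀ (m : ℕ) (s : ℕ → 𝒳),
      Tendsto (fun n : ℕ => (cnt ω m s 0 ((n : ℤ) - 1) : ℝ) / n) atTop (𝓝 (pstr μ m s)))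
    {K : ℕ} (hK : ∀ k < K, ¬ IsMemoryBound μ (tildePast l ω) k) :
    ∀ᶠ n in atTop, K ≤ chi β γ l ω n := by
  have hlt : ∀ᶠ n : ℕ in atTop, ∀ k < K, (n : ℝ) ^ (-β) < hatDelta γ l ω n k :=
    (finite_lt_nat K).eventually_all.2 fun k hk => eventually_lt_hatDelta hT hβ hγ h (hK k hk)
  filter_upwards [hlt, eventually_ge_atTop 1] with n hn h1
  by_contra! hc
  exact absurd (chi_mem h1).2 (not_le.2 (hn _ hc))

lemma IsGood.eventually_apply_lambda_sub (h : IsGood l ω) (hl : Monotone l)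
    (hl' : Tendsto l atTop atTop) {K : ℕ} (hK : ∀ᶠ n in atTop, K ≤ chi β γ l ω n) :
    ∀ᶠ j in atTop, ∀ r < K, ω (lambda β γ l ω j - (r : ℤ)) = tildePast l ω r := by
  obtain ⟨N, hN⟩ := eventually_atTop.1 hK
  obtain ⟨J, hJ⟩ := eventually_atTop.1 (hl'.eventually_ge_atTop K)
  refine eventually_atTop.2 ⟨N + (zeta l ω (J + 1)).toNat + 1, fun j hj r hr => ?_⟩
  obtain ⟨j, rfl⟩ : ∃ j', j = j' + 1 := ⟨j - 1, by omega⟩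
  have h1 := le_lambda (β := β) (γ := γ) (l := l) (ω := ω) j
  have h2 := le_lambda (β := β) (γ := γ) (l := l) (ω := ω) (j + 1)
  have h3 : zeta l ω (J + 1) ≤ lambda β γ l ω j := by omega
  have h4 := h.strictMono.lt_iff_lt.1 (h3.trans_lt (h.jIndex_spec (lambda_nonneg j)).2)
  rw [h.lambda_succ_spec hl hl' j r (hr.trans_le (hN _ (by omega))),
    h.tildePast_eq hl hl' (n := jIndex l ω (lambda β γ l ω j)) (by omega)
      (hr.trans_le (hJ _ (by omega)))]

end Consistency

/-- Step 3, finitarily Markovian case. On the event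
`{K(X̃⁰_{-∞}) < ∞}`, almost surely, eventually in `j`,
`E(f(X_{λ_j+1}) | X_{-∞}^{λ_j}) = E(f(X_{λ_j+1}) | X_0^{λ_j}) = F(X̃⁰_{-∞})`. -/
theorem statement15
    {𝒳 : Type*} [Countable 𝒳] [MeasurableSpace 𝒳] [MeasurableSingletonClass 𝒳]
    (μ : Measure (Path 𝒳)) [IsProbabilityMeasure μ]
    (hErg : Ergodic (shift : Path 𝒳 → Path 𝒳) μ)
    (l : ℕ → ℕ) (hl1 : l 1 = 1) (hlmono : Monotone l)
    (hlle : ∀ k, 1 ≤ k → l k ≤ k) (hltop : Tendsto l atTop atTop)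
    (β γ : ℝ) (hγ0 : 0 < γ) (hγ1 : γ < 1) (hβ0 : 0 < β) (hβγ : 2 * β + γ < 1)
    (f : 𝒳 → ℝ) (hf : ∃ M, ∀ x, |f x| ≤ M)
    (F : (ℕ → 𝒳) → ℝ) (hF : IsPredictor μ f F) :
    ∀ᵐ ω ∂μ, memLen μ (tildePast l ω) ≠ ⊤ →
      ∀ᶠ j in atTop,
        (μ[fun ω' => f (ω' (lambda β γ l ω' j + 1))|fullPastSigma β γ l j]) ω =
          (μ[fun ω' => f (ω' (lambda β γ l ω' j + 1))|segSigma β γ l j]) ω ∧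
        (μ[fun ω' => f (ω' (lambda β γ l ω' j + 1))|segSigma β γ l j]) ω =
          F (tildePast l ω) := by
  have hT := hErg.toMeasurePreserving
  filter_upwards [ae_isGood hT l, ae_tendsto_cnt hErg,
    ae_all_iff.2 fun j => ae_condExp_lambda_eq (β := β) (γ := γ) (j := j) hT hlmono hltop hlle hf
      le_rfl (segSigma_le j),
    ae_all_iff.2 fun j => ae_condExp_lambda_eq (β := β) (γ := γ) (j := j) hT hlmono hltop hlle hf
      (segSigma_le j) le_rfl,
    ae_tildePast_of_ae_past hT hlmono hltop
      (p := fun x => ∀ K, IsMemoryBound μ x K → F x = nextMean μ f K x) (ae_predictor_eq hT hf hF)]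
    with ω hgood hcnt hseg hfull hpred hfin
  have hex : ∃ K, IsMemoryBound μ (tildePast l ω) K := by
    by_contra! hno
    refine hfin (sInf_eq_top.2 ?_)
    rintro _ ⟨K, -, hK⟩
    exact (hno K hK).elim
  classical
  have hchi := eventually_le_chi (l := l) hT hβ0 hγ0 hcnt fun k hk => Nat.find_min hex hk
  filter_upwards [hgood.eventually_apply_lambda_sub hlmono hltop hchi,
    eventually_ge_atTop (Nat.find hex)] with j hj hKj
  obtain ⟨t, ht⟩ := Int.eq_ofNat_of_zero_le (lambda_nonneg (β := β) (γ := γ) (l := l) (ω := ω) j)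
  have hKt : Nat.find hex ≤ t := by
    have := le_lambda (β := β) (γ := γ) (l := l) (ω := ω) j
    omega
  rw [ht] at hj
  rw [hseg j t _ _ (Nat.find_spec hex) hKt ht hj, hfull j t _ _ (Nat.find_spec hex) hKt ht hj]
  exact ⟨rfl, (hpred _ (Nat.find_spec hex)).symm⟩

end MWPrediction
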